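/- For 1 ≤ t ≤ 5, let T_t : P_4 → P_5 be the 𝔽₂-algebra homomorphism with T_t(x_i) = x_i for 1 ≤ i < t and T_t(x_i) = x_{i+1} for t ≤ i ≤ 4. Then the set of classes in (QP_5)_67 of the monomials T_t(y), for 1 ≤ t ≤ 5 and y an admissible monomial of degree 67 in P_4, is a basis of (QP_5^0)_67, and this set of classes has exactly 460 elements. -/

import Mathlib

open MvPolynomial

noncomputable section

/-- `P n` is the polynomial algebra `𝔽₂[x_1, …, x_n]`. -/
abbrev P (n : ℕ) : Type := MvPolynomial (Fin n) (ZMod 2)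

/-- The total Steenrod square: the `𝔽₂`-algebra endomorphism of `P n`
with `Sq (x_j) = x_j + x_j ^ 2`. -/
def SqT (n : ℕ) : P n →ₐ[ZMod 2] P n := aeval fun j => X j + X j ^ 2

/-- `u` is hit (in degree `d`): `u = ∑_{i ≥ 1} Sq^i (f i)` where `f i` is homogeneous
of degree `d - i`; here `Sq^i (f i)` is the degree-`d` homogeneous component of
`Sq (f i)`. -/
def IsHit (n d : ℕ) (u : P n) : Prop :=
  ∃ f : ℕ → P n,
    (∀ i, f i ∈ homogeneousSubmodule (Fin n) (ZMod 2) (d - i)) ∧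
    u = ∑ i ∈ Finset.Icc 1 d, homogeneousComponent d (SqT n (f i))

/-- The homogeneous part `(P_n)_d`. -/
abbrev homSub (n d : ℕ) : Submodule (ZMod 2) (P n) := homogeneousSubmodule (Fin n) (ZMod 2) d

/-- The subspace of hit elements of degree `d` (the span of the set of hit elements;
this set is already closed under addition, so this is just the set of hit elements). -/
def hitSub (n d : ℕ) : Submodule (ZMod 2) (P n) := Submodule.span (ZMod 2) {u | IsHit n d u}

/-- The cohit space `(QP_n)_d = (P_n)_d / (A⁺P_n)_d`. -/
abbrev QP (n d : ℕ) : Type :=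
  ↥(homSub n d) ⧸ (hitSub n d).comap (homSub n d).subtype

/-- The class `[f]` in `(QP_n)_d` of a polynomial `f` (via its degree-`d` homogeneous
component; for `f` homogeneous of degree `d` this is the class of `f` itself). -/
def cls (n d : ℕ) (f : P n) : QP n d :=
  Submodule.Quotient.mk
    ⟨homogeneousComponent d f,
      (mem_homogeneousSubmodule _ _).2 (homogeneousComponent_isHomogeneous d f)⟩

/-- The monomial `x^a = x_1^{a_1} ⋯ x_n^{a_n}`. -/
def mono {n : ℕ} (a : Fin n →₀ ℕ) : P n := monomial a 1

/-- The (total) degree of the monomial with exponent vector `a`. -/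
def degA {n : ℕ} (a : Fin n →₀ ℕ) : ℕ := ∑ i, a i

/-- The weight vector: `wVec a t = ω_{t+1}(x^a) = ∑_j α_t(a_j)`. -/
def wVec {n : ℕ} (a : Fin n →₀ ℕ) : ℕ → ℕ :=
  fun t => ∑ j, if Nat.testBit (a j) t then 1 else 0

/-- Left lexicographic (strict) order on sequences. -/
def lexLtN (f g : ℕ → ℕ) : Prop := ∃ i, (∀ j, j < i → f j = g j) ∧ f i < g i

/-- Left lexicographic (strict) order on exponent vectors. -/
def lexLtS {n : ℕ} (a b : Fin n →₀ ℕ) : Prop :=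
  ∃ i : Fin n, (∀ j, j < i → a j = b j) ∧ a i < b i

/-- The order on monomials: `u < v` iff `ω(u) < ω(v)` lexicographically, or
`ω(u) = ω(v)` and `σ(u) < σ(v)` lexicographically. -/
def monLt {n : ℕ} (a b : Fin n →₀ ℕ) : Prop :=
  lexLtN (wVec a) (wVec b) ∨ (wVec a = wVec b ∧ lexLtS a b)

/-- A monomial is admissible iff it is not inadmissible, i.e. there is no finite set of
monomials of the same degree, all smaller than it, such that subtracting their sum
yields a hit polynomial. -/
def Admissible {n : ℕ} (a : Fin n →₀ ℕ) : Prop :=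
  ¬ ∃ S : Finset (Fin n →₀ ℕ),
      (∀ b ∈ S, degA b = degA a ∧ monLt b a) ∧
      IsHit n (degA a) (mono a - ∑ b ∈ S, mono b)

/-- `P_n^0`: the span of the monomials in which some variable has exponent `0`. -/
def PzeroSub (n : ℕ) : Submodule (ZMod 2) (P n) :=
  Submodule.span (ZMod 2) {x : P n | ∃ a : Fin n →₀ ℕ, (∃ i, a i = 0) ∧ x = mono a}

/-- `P_n^+`: the span of the monomials in which every variable occurs. -/
def PplusSub (n : ℕ) : Submodule (ZMod 2) (P n) :=
  Submodule.span (ZMod 2) {x : P n | ∃ a : Fin n →₀ ℕ, (∀ i, 0 < a i) ∧ x = mono a}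

/-- `(QP_n^0)_d`: the image of `(P_n^0)_d` in `(QP_n)_d`. -/
def Qzero (n d : ℕ) : Submodule (ZMod 2) (QP n d) :=
  (((PzeroSub n).comap (homSub n d).subtype)).map
    ((hitSub n d).comap (homSub n d).subtype).mkQ

/-- `(QP_n^+)_d`: the image of `(P_n^+)_d` in `(QP_n)_d`. -/
def Qplus (n d : ℕ) : Submodule (ZMod 2) (QP n d) :=
  (((PplusSub n).comap (homSub n d).subtype)).map
    ((hitSub n d).comap (homSub n d).subtype).mkQ

/-- Kameko-type map `S_5 : P_5 → P_5`, the `𝔽₂`-linear map with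
`S_5(x_1x_2x_3x_4x_5 · y²) = y` on monomials of that form and `S_5 = 0` on all
other monomials. -/
def S5 : P 5 →ₗ[ZMod 2] P 5 :=
  (basisMonomials (Fin 5) (ZMod 2)).constr (ZMod 2) fun a =>
    if ∀ i, Odd (a i) then mono (Finsupp.equivFunOnFinite.symm fun i => a i / 2) else 0

/-- `Φ(f) = x_1x_2x_3x_4x_5 · f²`. -/
def Phi (f : P 5) : P 5 := (∏ i : Fin 5, X i) * f ^ 2

/-- The substitution `T_t : P_4 → P_5`, `x_i ↦ x_i` for `i < t` and `x_i ↦ x_{i+1}`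
for `i ≥ t` (0-indexed). -/
def Tmap (t : Fin 5) : P 4 →ₐ[ZMod 2] P 5 :=
  rename fun i : Fin 4 => if (i : ℕ) < (t : ℕ) then i.castSucc else i.succ

/-- The set of classes in `(QP_5)_67` of the monomials `T_t(y)` with `y` an admissible
monomial of degree `67` in `P_4`. -/
def Sset : Set (QP 5 67) :=
  {x | ∃ t : Fin 5, ∃ a : Fin 4 →₀ ℕ,
    degA a = 67 ∧ Admissible a ∧ x = cls 5 67 (Tmap t (mono a))}

/-! ### Part 1: order, monomial formula for the squares, hits -/

/-- Bitwise subsets of `m`. -/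
def BB (m : ℕ) : Finset ℕ := (Finset.range (m + 1)).filter (fun c => m &&& c = c)

theorem mem_BB {m c : ℕ} : c ∈ BB m ↔ m &&& c = c := by
  unfold BB
  rw [Finset.mem_filter, Finset.mem_range]
  constructor
  · exact fun h => h.2
  · intro h
    refine ⟨?_, h⟩
    have : m &&& c ≤ m := Nat.and_le_left
    omega

theorem mem_BB_iff {m c : ℕ} : c ∈ BB m ↔ ∀ t, c.testBit t = true → m.testBit t = true := by
  rw [mem_BB]
  constructor
  · intro h t ht
    rw [← h, Nat.testBit_and] at ht
    simp at ht
    exact ht.1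
  · intro h
    apply Nat.eq_of_testBit_eq
    intro t
    rw [Nat.testBit_and]
    have := h t
    cases hc : c.testBit t <;> simp_all

theorem choose_cast (m c : ℕ) :
    ((m.choose c : ℕ) : ZMod 2) = if m &&& c = c then 1 else 0 := by
  induction m using Nat.strong_induction_on generalizing c with
  | _ m ih =>
    rcases Nat.eq_zero_or_pos m with hm | hm
    · subst hm
      rcases Nat.eq_zero_or_pos c with hc | hc
      · subst hc; simp
      · rw [Nat.choose_eq_zero_of_lt hc]
        have : ¬ (0 &&& c = c) := by simp; omega
        rw [if_neg this]; simp
    · have : Fact (Nat.Prime 2) := ⟨Nat.prime_two⟩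
      have h := Choose.choose_modEq_choose_mod_mul_choose_div_nat (n := m) (k := c) (p := 2)
      have h' := (ZMod.natCast_eq_natCast_iff _ _ 2).2 h
      rw [h', Nat.cast_mul, ih (m / 2) (by omega)]
      have key : (m &&& c = c) ↔ (m / 2 &&& c / 2 = c / 2) ∧ (c % 2 = 1 → m % 2 = 1) := by
        rw [← mem_BB, ← mem_BB, mem_BB_iff, mem_BB_iff]
        constructor
        · intro hh
          refine ⟨fun t => ?_, ?_⟩
          · have := hh (t + 1)
            rw [Nat.testBit_add_one, Nat.testBit_add_one] at this
            exact this
          · have := hh 0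
            simpa [Nat.testBit_zero] using this
        · rintro ⟨h1, h2⟩ t
          cases t with
          | zero => simpa [Nat.testBit_zero] using h2
          | succ t =>
            rw [Nat.testBit_add_one, Nat.testBit_add_one]
            exact h1 t
      rcases Nat.mod_two_eq_zero_or_one m with h1 | h1 <;>
      rcases Nat.mod_two_eq_zero_or_one c with h2 | h2 <;>
      simp [h1, h2, key]

theorem X_sq_pow (n : ℕ) (j : Fin n) (m : ℕ) :
    ((X j + X j ^ 2 : P n)) ^ m = ∑ c ∈ BB m, X j ^ (m + c) := by
  have : (X j + X j ^ 2 : P n) = X j * (X j + 1) := by ring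
  rw [this, mul_pow, add_pow, Finset.mul_sum]
  unfold BB
  rw [Finset.sum_filter]
  apply Finset.sum_congr rfl
  intro c hc
  have h2 : ((m.choose c : ℕ) : P n) = if m &&& c = c then 1 else 0 := by
    have : ((m.choose c : ℕ) : P n) = C ((m.choose c : ℕ) : ZMod 2) := by simp
    rw [this, choose_cast]
    split_ifs <;> simp
  rw [h2]
  split_ifs
  · rw [pow_add]; simp
  · simp

theorem SqT_mono {n : ℕ} (a : Fin n →₀ ℕ) :
    SqT n (mono a) = ∑ p ∈ Fintype.piFinset (fun j => BB (a j)),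
      mono (a + Finsupp.equivFunOnFinite.symm p) := by
  have h1 : ∀ b : Fin n →₀ ℕ, (mono b : P n) = ∏ j, X j ^ (b j) := by
    intro b
    unfold mono
    rw [monomial_eq]
    simp [Finsupp.prod_fintype]
  rw [h1, map_prod]
  have h2 : ∀ j, SqT n (X j ^ (a j)) = ∑ c ∈ BB (a j), X j ^ (a j + c) := by
    intro j
    rw [map_pow, ← X_sq_pow]
    simp [SqT]
  rw [Finset.prod_congr rfl (fun j _ => h2 j), Finset.prod_univ_sum]
  apply Finset.sum_congr rfl
  intro p _
  rw [h1]
  simp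

theorem degA_add {n : ℕ} (a b : Fin n →₀ ℕ) : degA (a + b) = degA a + degA b := by
  simp [degA, Finset.sum_add_distrib]

theorem mono_hom {n : ℕ} (a : Fin n →₀ ℕ) : (mono a : P n).IsHomogeneous (degA a) := by
  apply isHomogeneous_monomial
  simp [degA, Finsupp.degree_eq_sum]

theorem homComp_mono {n : ℕ} (d : ℕ) (a : Fin n →₀ ℕ) :
    homogeneousComponent d (mono a : P n) = if degA a = d then mono a else 0 := by
  rw [homogeneousComponent_of_mem ((mem_homogeneousSubmodule _ _).2 (mono_hom a))]
  simp [eq_comm]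

/-- `Sq^i (x^a)`. -/
def sqm {n : ℕ} (i : ℕ) (a : Fin n →₀ ℕ) : P n :=
  ∑ p ∈ (Fintype.piFinset (fun j => BB (a j))).filter (fun p => ∑ j, p j = i),
      mono (a + Finsupp.equivFunOnFinite.symm p)

theorem sqm_eq {n : ℕ} (i : ℕ) (a : Fin n →₀ ℕ) :
    homogeneousComponent (degA a + i) (SqT n (mono a)) = sqm i a := by
  rw [SqT_mono, map_sum, sqm, Finset.sum_filter]
  apply Finset.sum_congr rfl
  intro p _
  rw [homComp_mono, degA_add]
  have : degA (Finsupp.equivFunOnFinite.symm p : Fin n →₀ ℕ) = ∑ j, p j := by simp [degA]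
  simp [this]

theorem isHit_zero (n d : ℕ) : IsHit n d 0 :=
  ⟨fun _ => 0, fun _ => Submodule.zero_mem _, by simp⟩

theorem isHit_add {n d : ℕ} {u v : P n} (hu : IsHit n d u) (hv : IsHit n d v) :
    IsHit n d (u + v) := by
  obtain ⟨f, hf, rfl⟩ := hu
  obtain ⟨g, hg, rfl⟩ := hv
  refine ⟨f + g, fun i => Submodule.add_mem _ (hf i) (hg i), ?_⟩
  simp [Finset.sum_add_distrib]

theorem isHit_smul {n d : ℕ} {u : P n} (c : ZMod 2) (hu : IsHit n d u) :
    IsHit n d (c • u) := by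
  obtain ⟨f, hf, rfl⟩ := hu
  refine ⟨fun i => c • f i, fun i => Submodule.smul_mem _ _ (hf i), ?_⟩
  simp [Finset.smul_sum]

theorem mem_hitSub {n d : ℕ} {u : P n} : u ∈ hitSub n d ↔ IsHit n d u := by
  constructor
  · intro h
    refine Submodule.span_induction (p := fun x _ => IsHit n d x) ?_ ?_ ?_ ?_ h
    · intro x hx; exact hx
    · exact isHit_zero n d
    · intro x y _ _ hx hy; exact isHit_add hx hy
    · intro c x _ hx; exact isHit_smul c hx
  · intro h; exact Submodule.subset_span h

theorem isHit_single {n d i : ℕ} (hi : 1 ≤ i) (hid : i ≤ d) (g : P n)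
    (hg : g ∈ homogeneousSubmodule (Fin n) (ZMod 2) (d - i)) :
    IsHit n d (homogeneousComponent d (SqT n g)) := by
  refine ⟨Pi.single i g, ?_, ?_⟩
  · intro k
    by_cases hk : k = i
    · subst hk; simpa using hg
    · rw [Pi.single_eq_of_ne hk]; exact Submodule.zero_mem _
  · rw [Finset.sum_eq_single i]
    · simp
    · intro b _ hb; rw [Pi.single_eq_of_ne hb]; simp
    · intro h; simp at h; omega

theorem sqm_hit {n i : ℕ} (hi : 1 ≤ i) (a : Fin n →₀ ℕ) {d : ℕ} (hd : degA a + i = d) :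
    sqm i a ∈ hitSub n d := by
  rw [mem_hitSub, ← sqm_eq, hd]
  apply isHit_single hi (by omega)
  rw [mem_homogeneousSubmodule]
  have : d - i = degA a := by omega
  rw [this]; exact mono_hom a

/-- The order key. -/
def okey {n : ℕ} (a : Fin n →₀ ℕ) : Lex (Lex (ℕ → ℕ) × Lex (Fin n → ℕ)) :=
  toLex (toLex (wVec a), toLex (⇑a))

theorem okey_inj {n : ℕ} {a b : Fin n →₀ ℕ} (h : okey a = okey b) : a = b := by
  unfold okey at h
  have h1 := congrArg (fun z => ofLex (ofLex z).2) h
  exact DFunLike.coe_injective h1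

theorem lexLtN_iff (f g : ℕ → ℕ) : lexLtN f g ↔ toLex f < toLex g := Iff.rfl

theorem lexLtS_iff {n : ℕ} (a b : Fin n →₀ ℕ) : lexLtS a b ↔ toLex (⇑a) < toLex (⇑b) := Iff.rfl

theorem monLt_iff {n : ℕ} (a b : Fin n →₀ ℕ) : monLt a b ↔ okey a < okey b := by
  unfold monLt okey
  rw [Prod.Lex.toLex_lt_toLex, lexLtN_iff, lexLtS_iff]
  simp

/-- Smaller monomials plus hits. -/
def LowM {n : ℕ} (a : Fin n →₀ ℕ) : Submodule (ZMod 2) (P n) :=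
  Submodule.span (ZMod 2) {x | ∃ b : Fin n →₀ ℕ, degA b = degA a ∧ monLt b a ∧ x = mono b}

theorem zmod2_cases (c : ZMod 2) : c = 0 ∨ c = 1 := by
  revert c; decide

theorem span_sum {n : ℕ} (p : (Fin n →₀ ℕ) → Prop) (u : P n)
    (h : u ∈ Submodule.span (ZMod 2) {x : P n | ∃ b, p b ∧ x = mono b}) :
    ∃ S : Finset (Fin n →₀ ℕ), (∀ b ∈ S, p b) ∧ u = ∑ b ∈ S, mono b := by
  refine ⟨u.support, ?_, ?_⟩
  · refine Submodule.span_induction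
      (p := fun (x : P n) _ => ∀ b ∈ x.support, p b) ?_ ?_ ?_ ?_ h
    · rintro x ⟨b, hb, rfl⟩ c hc
      have := support_monomial_subset hc
      simp at this
      rw [this]; exact hb
    · simp
    · classical
      intro x y _ _ hx hy b hb
      rcases Finset.mem_union.1 (support_add hb) with h | h
      · exact hx b h
      · exact hy b h
    · intro c x _ hx b hb
      exact hx b (support_smul hb)
  · conv_lhs => rw [u.as_sum]
    apply Finset.sum_congr rfl
    intro b hb
    rcases zmod2_cases (coeff b u) with h0 | h0
    · rw [mem_support_iff] at hb; exact absurd h0 hb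
    · rw [h0]; rfl

theorem not_adm_iff {n : ℕ} (a : Fin n →₀ ℕ) :
    ¬ Admissible a ↔ mono a ∈ LowM a ⊔ hitSub n (degA a) := by
  unfold Admissible
  rw [not_not, Submodule.mem_sup]
  constructor
  · rintro ⟨S, hS, hh⟩
    refine ⟨∑ b ∈ S, mono b, ?_, _, mem_hitSub.2 hh, by ring⟩
    apply Submodule.sum_mem
    intro b hb
    exact Submodule.subset_span ⟨b, (hS b hb).1, (hS b hb).2, rfl⟩
  · rintro ⟨y, hy, z, hz, hyz⟩
    have hy' : y ∈ Submodule.span (ZMod 2) {x : P n | ∃ b, (degA b = degA a ∧ monLt b a) ∧ x = mono b} := by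
      have := hy
      unfold LowM at this
      simpa only [and_assoc] using this
    obtain ⟨S, hS, rfl⟩ := span_sum _ _ hy'
    refine ⟨S, hS, ?_⟩
    rw [← mem_hitSub]
    have : mono a - ∑ b ∈ S, mono b = z := by rw [← hyz]; ring
    rw [this]; exact hz

/-! ### Part 2: strictly inadmissible factors -/

theorem testBit_low (x y r t : ℕ) (ht : t < r) :
    (x + 2 ^ r * y).testBit t = x.testBit t := by
  have h : (x + 2 ^ r * y) % 2 ^ r = x % 2 ^ r := by simp
  have h1 := Nat.testBit_mod_two_pow (x + 2 ^ r * y) r t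
  have h2 := Nat.testBit_mod_two_pow x r t
  rw [h, h2] at h1
  simpa [ht] using h1.symm

theorem testBit_high (x y r t : ℕ) (hx : x < 2 ^ r) :
    (x + 2 ^ r * y).testBit (r + t) = y.testBit t := by
  rw [add_comm x, Nat.testBit_two_pow_mul_add _ hx]
  simp

/-- Embedding of the block `v`. -/
def emb {n : ℕ} (x z : Fin n →₀ ℕ) (r s : ℕ) (v : Fin n →₀ ℕ) : Fin n →₀ ℕ :=
  x + 2 ^ r • (v + 2 ^ s • z)

theorem emb_apply {n : ℕ} (x z : Fin n →₀ ℕ) (r s : ℕ) (v : Fin n →₀ ℕ) (j : Fin n) :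
    emb x z r s v j = x j + 2 ^ r * (v j + 2 ^ s * z j) := by
  simp [emb]; ring

theorem degA_smul {n : ℕ} (k : ℕ) (a : Fin n →₀ ℕ) : degA (k • a) = k * degA a := by
  simp [degA, Finset.mul_sum]

theorem degA_emb {n : ℕ} (x z : Fin n →₀ ℕ) (r s : ℕ) (v : Fin n →₀ ℕ) :
    degA (emb x z r s v) = degA x + 2 ^ r * (degA v + 2 ^ s * degA z) := by
  simp only [emb, degA_add, degA_smul]

theorem wVec_emb_low {n : ℕ} (x z : Fin n →₀ ℕ) (r s : ℕ) (v : Fin n →₀ ℕ) (t : ℕ) (ht : t < r) :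
    wVec (emb x z r s v) t = wVec x t := by
  unfold wVec
  apply Finset.sum_congr rfl
  intro j _
  rw [emb_apply, testBit_low _ _ _ _ ht]

theorem wVec_emb_mid {n : ℕ} (x z : Fin n →₀ ℕ) (r s : ℕ) (v : Fin n →₀ ℕ)
    (hx : ∀ j, x j < 2 ^ r) (t : ℕ) (ht : t < s) :
    wVec (emb x z r s v) (r + t) = wVec v t := by
  unfold wVec
  apply Finset.sum_congr rfl
  intro j _
  rw [emb_apply, testBit_high _ _ _ _ (hx j), testBit_low _ _ _ _ ht]

theorem wVec_emb_high {n : ℕ} (x z : Fin n →₀ ℕ) (r s : ℕ) (v : Fin n →₀ ℕ)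
    (hx : ∀ j, x j < 2 ^ r) (hv : ∀ j, v j < 2 ^ s) (t : ℕ) :
    wVec (emb x z r s v) (r + (s + t)) = wVec z t := by
  unfold wVec
  apply Finset.sum_congr rfl
  intro j _
  rw [emb_apply, testBit_high _ _ _ _ (hx j), testBit_high _ _ _ _ (hv j)]

theorem wVec_zero_of_lt {n : ℕ} (w : Fin n →₀ ℕ) (s : ℕ) (hw : ∀ j, w j < 2 ^ s) (t : ℕ)
    (ht : s ≤ t) : wVec w t = 0 := by
  unfold wVec
  apply Finset.sum_eq_zero
  intro j _
  rw [Nat.testBit_lt_two_pow (lt_of_lt_of_le (hw j) (Nat.pow_le_pow_right (by norm_num) ht))]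
  simp

theorem lt_of_wVec_zero {n : ℕ} (w : Fin n →₀ ℕ) (s : ℕ) (h : ∀ t, s ≤ t → wVec w t = 0) (j : Fin n) :
    w j < 2 ^ s := by
  apply Nat.lt_pow_two_of_testBit
  intro t ht
  have := h t ht
  unfold wVec at this
  rw [Finset.sum_eq_zero_iff] at this
  have := this j (Finset.mem_univ j)
  simpa using this

theorem emb_lt {n : ℕ} (x z : Fin n →₀ ℕ) (r s : ℕ) (v w : Fin n →₀ ℕ)
    (hx : ∀ j, x j < 2 ^ r) (hw : ∀ j, w j < 2 ^ s) (h : monLt v w) :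
    monLt (emb x z r s v) (emb x z r s w) := by
  rcases h with ⟨i, hi, hlt⟩ | ⟨he, i, hi, hlt⟩
  · left
    have his : i < s := by
      by_contra hc
      rw [wVec_zero_of_lt w s hw i (by omega)] at hlt
      omega
    refine ⟨r + i, ?_, ?_⟩
    · intro t ht
      by_cases htr : t < r
      · rw [wVec_emb_low _ _ _ _ _ _ htr, wVec_emb_low _ _ _ _ _ _ htr]
      · obtain ⟨k, rfl⟩ := Nat.exists_eq_add_of_le (not_lt.1 htr)
        rw [wVec_emb_mid _ _ _ _ _ hx _ (by omega), wVec_emb_mid _ _ _ _ _ hx _ (by omega)]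
        exact hi k (by omega)
    · rw [wVec_emb_mid _ _ _ _ _ hx _ his, wVec_emb_mid _ _ _ _ _ hx _ his]
      exact hlt
  · right
    have hv : ∀ j, v j < 2 ^ s := by
      apply lt_of_wVec_zero
      intro t ht
      rw [he]; exact wVec_zero_of_lt w s hw t ht
    refine ⟨?_, i, ?_, ?_⟩
    · funext t
      by_cases htr : t < r
      · rw [wVec_emb_low _ _ _ _ _ _ htr, wVec_emb_low _ _ _ _ _ _ htr]
      · obtain ⟨k, rfl⟩ := Nat.exists_eq_add_of_le (not_lt.1 htr)
        by_cases hk : k < s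
        · rw [wVec_emb_mid _ _ _ _ _ hx _ hk, wVec_emb_mid _ _ _ _ _ hx _ hk, he]
        · obtain ⟨m, rfl⟩ := Nat.exists_eq_add_of_le (not_lt.1 hk)
          rw [wVec_emb_high _ _ _ _ _ hx hv, wVec_emb_high _ _ _ _ _ hx hw]
    · intro j hj
      rw [emb_apply, emb_apply, hi j hj]
    · rw [emb_apply, emb_apply]
      have : 0 < 2 ^ r := by positivity
      have h2 : v i + 2 ^ s * z i < w i + 2 ^ s * z i := by omega
      have := Nat.mul_lt_mul_of_pos_left h2 this
      omega

theorem odd_step (u p t : ℕ) (h : ∀ k, k < t → p.testBit k = false) :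
    (∀ k, k < t → (u + p).testBit k = u.testBit k) ∧
      (u + p).testBit t = (u.testBit t ^^ p.testBit t) := by
  have hp : p % 2 ^ t = 0 := by
    apply Nat.eq_of_testBit_eq
    intro k
    rw [Nat.testBit_mod_two_pow]
    by_cases hk : k < t
    · simp [hk, h k hk]
    · simp [hk]
  obtain ⟨m, rfl⟩ := Nat.dvd_of_mod_eq_zero hp
  refine ⟨fun k hk => testBit_low _ _ _ _ hk, ?_⟩
  have e1 : u + 2 ^ t * m = u % 2 ^ t + 2 ^ t * (u / 2 ^ t + m) := by
    have := Nat.mod_add_div u (2 ^ t)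
    rw [mul_add]; omega
  have e2 : u.testBit t = (u / 2 ^ t).testBit 0 := by
    rw [Nat.testBit_div_two_pow]; simp
  have e3 : (2 ^ t * m).testBit t = m.testBit 0 := by
    have := testBit_high 0 m t 0 (by positivity)
    simpa using this
  have e4 := testBit_high (u % 2 ^ t) (u / 2 ^ t + m) t 0 (Nat.mod_lt _ (by positivity))
  rw [e1, e2, e3]
  rw [add_zero] at e4
  rw [e4]
  simp only [Nat.testBit_zero]
  rcases Nat.mod_two_eq_zero_or_one (u / 2 ^ t) with h1 | h1 <;>
  rcases Nat.mod_two_eq_zero_or_one m with h2 | h2 <;>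
  simp [Nat.add_mod, h1, h2]

theorem move_lt {n : ℕ} (a' a : Fin n →₀ ℕ) (r : ℕ) (p : Fin n →₀ ℕ)
    (hp : ∀ j, p j ∈ BB (a' j)) (hnd : ¬ ∀ j, 2 ^ r ∣ p j)
    (hw : ∀ t, t < r → wVec a' t = wVec a t) : monLt (a' + p) a := by
  left
  have hex : ∃ t, ∃ j, (p j).testBit t = true := by
    by_contra hc
    push Not at hc
    apply hnd
    intro j
    have : p j = 0 := by
      apply Nat.eq_of_testBit_eq
      intro t
      have := hc t j
      simpa using this
    rw [this]; exact dvd_zero _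
  classical
  have hspec := Nat.find_spec hex
  have hmin := fun m => Nat.find_min hex (m := m)
  set t := Nat.find hex
  have hlow : ∀ j, ∀ k, k < t → (p j).testBit k = false := by
    intro j k hk
    have := hmin k hk
    push Not at this
    simpa using this j
  have htr : t < r := by
    by_contra hc
    apply hnd
    intro j
    apply Nat.dvd_of_mod_eq_zero
    apply Nat.eq_of_testBit_eq
    intro k
    rw [Nat.testBit_mod_two_pow]
    by_cases hk : k < r
    · simp [hk, hlow j k (by omega)]
    · simp [hk]
  refine ⟨t, ?_, ?_⟩
  · intro k hk
    rw [← hw k (by omega)]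
    unfold wVec
    apply Finset.sum_congr rfl
    intro j _
    rw [Finsupp.add_apply, (odd_step _ _ _ (hlow j)).1 k hk]
  · rw [← hw t htr]
    unfold wVec
    apply Finset.sum_lt_sum
    · intro j _
      rw [Finsupp.add_apply, (odd_step _ _ _ (hlow j)).2]
      have := mem_BB_iff.1 (hp j) t
      cases h1 : (p j).testBit t <;> cases h2 : (a' j).testBit t <;> simp_all
    · obtain ⟨j, hj⟩ := hspec
      refine ⟨j, Finset.mem_univ j, ?_⟩
      rw [Finsupp.add_apply, (odd_step _ _ _ (hlow j)).2]
      have := mem_BB_iff.1 (hp j) t hj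
      simp [hj, this]

/-- The linear map `x^v ↦ x^(emb v)`. -/
def embL {n : ℕ} (x z : Fin n →₀ ℕ) (r s : ℕ) : P n →ₗ[ZMod 2] P n :=
  (basisMonomials (Fin n) (ZMod 2)).constr (ZMod 2) fun v => mono (emb x z r s v)

theorem embL_mono {n : ℕ} (x z : Fin n →₀ ℕ) (r s : ℕ) (v : Fin n →₀ ℕ) :
    embL x z r s (mono v) = mono (emb x z r s v) := by
  have := (basisMonomials (Fin n) (ZMod 2)).constr_basis (ZMod 2)
    (fun v => (mono (emb x z r s v) : P n)) v
  rw [coe_basisMonomials] at this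
  exact this

theorem BB_block (x h z r s c : ℕ) (hx : x < 2 ^ r) (hc : c < 2 ^ s) :
    2 ^ r * c ∈ BB (x + 2 ^ r * (h + 2 ^ s * z)) ↔ c ∈ BB h := by
  rw [mem_BB_iff, mem_BB_iff]
  have e : ∀ t, (2 ^ r * c).testBit (r + t) = c.testBit t := by
    intro t
    have := testBit_high 0 c r t (by positivity)
    simpa using this
  constructor
  · intro hh t ht
    have hts : t < s := by
      by_contra hcon
      rw [Nat.testBit_lt_two_pow (lt_of_lt_of_le hc
        (Nat.pow_le_pow_right (by norm_num) (not_lt.1 hcon)))] at ht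
      simp at ht
    have := hh (r + t) (by rw [e]; exact ht)
    rw [testBit_high _ _ _ _ hx, testBit_low _ _ _ _ hts] at this
    exact this
  · intro hh t ht
    by_cases htr : t < r
    · have := testBit_low 0 c r t htr
      simp only [zero_add] at this
      rw [this] at ht
      simp at ht
    · obtain ⟨k, rfl⟩ := Nat.exists_eq_add_of_le (not_lt.1 htr)
      rw [e] at ht
      have hts : k < s := by
        by_contra hcon
        rw [Nat.testBit_lt_two_pow (lt_of_lt_of_le hc
          (Nat.pow_le_pow_right (by norm_num) (not_lt.1 hcon)))] at ht
        simp at ht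
      rw [testBit_high _ _ _ _ hx, testBit_low _ _ _ _ hts]
      exact hh k ht

theorem embL_sqm {n : ℕ} (x z : Fin n →₀ ℕ) (r s i : ℕ) (w h : Fin n →₀ ℕ)
    (hx : ∀ j, x j < 2 ^ r) (hi : 1 ≤ i) (his : i < 2 ^ s) (hd : degA h + i = degA w) :
    embL x z r s (sqm i h) ∈ LowM (emb x z r s w) ⊔ hitSub n (degA (emb x z r s w)) := by
  classical
  set a' := emb x z r s h with ha'
  have hdeg : degA a' + 2 ^ r * i = degA (emb x z r s w) := by
    rw [ha', degA_emb, degA_emb, ← hd]; ring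
  have hhit : sqm (2 ^ r * i) a' ∈ hitSub n (degA (emb x z r s w)) :=
    sqm_hit (Nat.one_le_iff_ne_zero.2 (by positivity)) a' hdeg
  have hsplit := Finset.sum_filter_add_sum_filter_not
    ((Fintype.piFinset (fun j => BB (a' j))).filter (fun p => ∑ j, p j = 2 ^ r * i))
    (fun p => ∀ j, 2 ^ r ∣ p j)
    (fun p => (mono (a' + Finsupp.equivFunOnFinite.symm p) : P n))
  have h2r : 0 < 2 ^ r := by positivity
  have hA : embL x z r s (sqm i h) = ∑ p ∈ ((Fintype.piFinset (fun j => BB (a' j))).filter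
      (fun p => ∑ j, p j = 2 ^ r * i)).filter (fun p => ∀ j, 2 ^ r ∣ p j),
      (mono (a' + Finsupp.equivFunOnFinite.symm p) : P n) := by
    unfold sqm
    rw [map_sum]
    refine Finset.sum_bij' (fun p _ => fun j => 2 ^ r * p j) (fun p _ => fun j => p j / 2 ^ r)
      ?_ ?_ ?_ ?_ ?_
    · intro p hp
      simp only [Finset.mem_filter, Fintype.mem_piFinset] at hp ⊢
      obtain ⟨hp1, hp2⟩ := hp
      refine ⟨⟨fun j => ?_, ?_⟩, fun j => dvd_mul_right _ _⟩
      · rw [ha', emb_apply, BB_block _ _ _ _ _ _ (hx j)]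
        · exact hp1 j
        · have : p j ≤ ∑ j, p j := Finset.single_le_sum (fun _ _ => Nat.zero_le _) (Finset.mem_univ j)
          omega
      · rw [← Finset.mul_sum, hp2]
    · intro p hp
      simp only [Finset.mem_filter, Fintype.mem_piFinset] at hp ⊢
      obtain ⟨⟨hp1, hp2⟩, hp3⟩ := hp
      choose q hq using hp3
      have hq' : ∀ j, p j / 2 ^ r = q j := fun j => by
        rw [hq j, Nat.mul_div_cancel_left _ h2r]
      have hsum : ∑ j, q j = i := by
        have : 2 ^ r * ∑ j, q j = 2 ^ r * i := by
          rw [Finset.mul_sum, ← hp2]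
          exact Finset.sum_congr rfl fun j _ => (hq j).symm
        exact Nat.eq_of_mul_eq_mul_left h2r this
      refine ⟨fun j => ?_, ?_⟩
      · rw [hq' j]
        have hb := hp1 j
        rw [hq j, ha', emb_apply, BB_block _ _ _ _ _ _ (hx j)] at hb
        · exact hb
        · have : q j ≤ ∑ j, q j := Finset.single_le_sum (fun _ _ => Nat.zero_le _) (Finset.mem_univ j)
          omega
      · rw [Finset.sum_congr rfl fun j _ => hq' j, hsum]
    · intro p _
      funext j
      simp
    · intro p hp
      simp only [Finset.mem_filter] at hp
      funext j
      exact Nat.mul_div_cancel' (hp.2 j)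
    · intro p _
      rw [embL_mono]
      congr 1
      ext j
      rw [emb_apply, Finsupp.add_apply, Finsupp.add_apply, ha', emb_apply]
      simp only [Finsupp.equivFunOnFinite_symm_apply_apply]
      ring
  have hB : ∑ p ∈ ((Fintype.piFinset (fun j => BB (a' j))).filter
      (fun p => ∑ j, p j = 2 ^ r * i)).filter (fun p => ¬ ∀ j, 2 ^ r ∣ p j),
      (mono (a' + Finsupp.equivFunOnFinite.symm p) : P n) ∈ LowM (emb x z r s w) := by
    apply Submodule.sum_mem
    intro p hp
    simp only [Finset.mem_filter, Fintype.mem_piFinset] at hp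
    obtain ⟨⟨hp1, hp2⟩, hp3⟩ := hp
    apply Submodule.subset_span
    refine ⟨_, ?_, ?_, rfl⟩
    · rw [degA_add, ← hdeg, ← hp2]
      simp [degA]
    · apply move_lt a' _ r
      · simpa using hp1
      · simpa using hp3
      · intro t ht
        rw [ha', wVec_emb_low _ _ _ _ _ _ ht, wVec_emb_low _ _ _ _ _ _ ht]
  rw [hA]
  rw [Submodule.mem_sup]
  refine ⟨_, Submodule.neg_mem _ hB, _, hhit, ?_⟩
  unfold sqm
  rw [← hsplit]
  ring

theorem strict_inadm {n : ℕ} (x z : Fin n →₀ ℕ) (r s : ℕ) (w : Fin n →₀ ℕ)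
    (cert : List (ℕ × (Fin n →₀ ℕ)))
    (hx : ∀ j, x j < 2 ^ r) (hw : ∀ j, w j < 2 ^ s)
    (hc : ∀ e ∈ cert, 1 ≤ e.1 ∧ e.1 < 2 ^ s ∧ degA e.2 + e.1 = degA w)
    (hsum : (cert.map fun e => sqm e.1 e.2).sum - mono w ∈ LowM w) :
    ¬ Admissible (emb x z r s w) := by
  rw [not_adm_iff]
  set K := LowM (emb x z r s w) ⊔ hitSub n (degA (emb x z r s w)) with hK
  have h1 : embL x z r s ((cert.map fun e => sqm e.1 e.2).sum) ∈ K := by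
    rw [map_list_sum]
    apply list_sum_mem
    intro y hy
    simp only [List.map_map, List.mem_map, Function.comp] at hy
    obtain ⟨e, he, rfl⟩ := hy
    obtain ⟨e1, e2, e3⟩ := hc e he
    exact embL_sqm x z r s e.1 w e.2 hx e1 e2 e3
  have h2 : ∀ y ∈ LowM w, embL x z r s y ∈ K := by
    intro y hy
    have hle : LowM w ≤ K.comap (embL x z r s) := by
      unfold LowM
      rw [Submodule.span_le]
      rintro _ ⟨b, hb1, hb2, rfl⟩
      change embL x z r s (mono b) ∈ K
      rw [embL_mono]
      apply Submodule.mem_sup_left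
      apply Submodule.subset_span
      exact ⟨_, by rw [degA_emb, degA_emb, hb1], emb_lt x z r s b w hx hw hb2, rfl⟩
    exact hle hy
  have h3 := h2 _ hsum
  rw [map_sub, embL_mono] at h3
  have h4 := Submodule.sub_mem _ h1 h3
  simpa using h4

/-! ### Part 3: computable certificates in four variables -/

/-- Exponent vector of a list. -/
def fl (l : List ℕ) : Fin 4 →₀ ℕ := Finsupp.equivFunOnFinite.symm fun j => l.getD j 0

theorem fl_apply (l : List ℕ) (j : Fin 4) : fl l j = l.getD j 0 := rfl

def subs (i a : ℕ) : List ℕ := (List.range (i + 1)).filter fun c => a &&& c == c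

def termsL (i : ℕ) : List ℕ → List (List ℕ)
  | [] => if i = 0 then [[]] else []
  | a :: as => (subs i a).flatMap fun c => (termsL (i - c) as).map (c :: ·)

theorem mem_termsL (h : List ℕ) : ∀ (i : ℕ) (l : List ℕ), l ∈ termsL i h ↔
    List.Forall₂ (fun c a => a &&& c = c) l h ∧ l.sum = i := by
  induction h with
  | nil =>
    intro i l
    unfold termsL
    by_cases hi : i = 0
    · subst hi
      simp only [if_true, List.mem_singleton, List.forall₂_nil_right_iff]
      constructor
      · rintro rfl; simp
      · exact fun h => h.1
    · simp only [if_neg hi, List.not_mem_nil, List.forall₂_nil_right_iff, false_iff]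
      rintro ⟨rfl, h⟩
      simp at h; omega
  | cons a as ih =>
    intro i l
    simp only [termsL, subs, List.mem_flatMap, List.mem_filter, List.mem_range, List.mem_map,
      beq_iff_eq, List.forall₂_cons_right_iff]
    constructor
    · rintro ⟨c, ⟨hc1, hc2⟩, q, hq, rfl⟩
      rw [ih] at hq
      refine ⟨⟨c, q, hc2, hq.1, rfl⟩, ?_⟩
      rw [List.sum_cons, hq.2]; omega
    · rintro ⟨⟨c, q, hc, hq, rfl⟩, hs⟩
      rw [List.sum_cons] at hs
      refine ⟨c, ⟨by omega, hc⟩, q, ?_, rfl⟩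
      rw [ih]
      exact ⟨hq, by omega⟩

theorem nodup_termsL (h : List ℕ) : ∀ (i : ℕ), (termsL i h).Nodup := by
  induction h with
  | nil => intro i; unfold termsL; split_ifs <;> simp
  | cons a as ih =>
    intro i
    unfold termsL
    rw [List.nodup_flatMap]
    refine ⟨fun c _ => (ih _).map (List.cons_injective), ?_⟩
    have hn : (subs i a).Nodup := List.nodup_range.filter _
    refine hn.imp ?_
    intro c c' hcc
    rw [Function.onFun, List.disjoint_left]
    rintro q h1 h2
    simp only [List.mem_map] at h1 h2
    obtain ⟨q1, _, rfl⟩ := h1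
    obtain ⟨q2, _, h3⟩ := h2
    simp at h3
    exact hcc h3.1.symm

theorem sum_termsL (i a b c d : ℕ) :
    ((termsL i [a, b, c, d]).map fun p => mono (fl [a, b, c, d] + fl p)).sum
      = sqm i (fl [a, b, c, d]) := by
  classical
  rw [← List.sum_toFinset _ (nodup_termsL _ _)]
  unfold sqm
  refine Finset.sum_bij' (fun p _ => fun j : Fin 4 => p.getD j 0) (fun p _ => [p 0, p 1, p 2, p 3])
    ?_ ?_ ?_ ?_ ?_
  · intro p hp
    rw [List.mem_toFinset, mem_termsL] at hp
    obtain ⟨hp, hs⟩ := hp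
    simp only [List.forall₂_cons_right_iff, List.forall₂_nil_right_iff] at hp
    obtain ⟨p0, _, h0, ⟨p1, _, h1, ⟨p2, _, h2, ⟨p3, _, h3, rfl, rfl⟩, rfl⟩, rfl⟩, rfl⟩ := hp
    rw [Finset.mem_filter, Fintype.mem_piFinset]
    refine ⟨?_, ?_⟩
    · intro j
      rw [mem_BB]
      fin_cases j
      · exact h0
      · exact h1
      · exact h2
      · exact h3
    · rw [← hs, Fin.sum_univ_four]
      simp
      ring
  · intro p hp
    rw [Finset.mem_filter, Fintype.mem_piFinset] at hp
    obtain ⟨hp, hs⟩ := hp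
    rw [List.mem_toFinset, mem_termsL]
    refine ⟨?_, ?_⟩
    · refine List.Forall₂.cons (mem_BB.1 (hp 0)) (List.Forall₂.cons (mem_BB.1 (hp 1))
        (List.Forall₂.cons (mem_BB.1 (hp 2)) (List.Forall₂.cons (mem_BB.1 (hp 3)) .nil)))
    · rw [← hs, Fin.sum_univ_four]
      simp
      ring
  · intro p hp
    rw [List.mem_toFinset, mem_termsL] at hp
    obtain ⟨hp, hs⟩ := hp
    simp only [List.forall₂_cons_right_iff, List.forall₂_nil_right_iff] at hp
    obtain ⟨p0, _, h0, ⟨p1, _, h1, ⟨p2, _, h2, ⟨p3, _, h3, rfl, rfl⟩, rfl⟩, rfl⟩, rfl⟩ := hp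
    rfl
  · intro p hp
    funext j
    fin_cases j <;> rfl
  · intro p hp
    rfl

def wtL (l : List ℕ) (t : ℕ) : ℕ :=
  ((l.getD 0 0).testBit t).toNat + ((l.getD 1 0).testBit t).toNat +
  ((l.getD 2 0).testBit t).toNat + ((l.getD 3 0).testBit t).toNat

theorem wVec_fl (l : List ℕ) (t : ℕ) : wVec (fl l) t = wtL l t := by
  unfold wVec wtL
  rw [Fin.sum_univ_four]
  have : ∀ b : Bool, (if b = true then 1 else 0) = b.toNat := by decide
  simp only [this]
  rfl

def smL (l : List ℕ) : ℕ := l.getD 0 0 + l.getD 1 0 + l.getD 2 0 + l.getD 3 0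

theorem degA_fl (l : List ℕ) : degA (fl l) = smL l := by
  unfold degA smL
  rw [Fin.sum_univ_four]
  rfl

def bdL (l : List ℕ) (k : ℕ) : Bool :=
  Nat.blt (l.getD 0 0) k && Nat.blt (l.getD 1 0) k && Nat.blt (l.getD 2 0) k && Nat.blt (l.getD 3 0) k

theorem bdL_iff (l : List ℕ) (k : ℕ) : bdL l k = true ↔ ∀ j, fl l j < k := by
  unfold bdL
  simp only [Bool.and_eq_true, Nat.blt_eq, Fin.forall_fin_succ, fl_apply]
  simp [and_assoc]

def lexB (v w : List ℕ) : Bool :=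
  Nat.blt (v.getD 0 0) (w.getD 0 0) || (Nat.beq (v.getD 0 0) (w.getD 0 0) &&
  (Nat.blt (v.getD 1 0) (w.getD 1 0) || (Nat.beq (v.getD 1 0) (w.getD 1 0) &&
  (Nat.blt (v.getD 2 0) (w.getD 2 0) || (Nat.beq (v.getD 2 0) (w.getD 2 0) &&
  Nat.blt (v.getD 3 0) (w.getD 3 0))))))

theorem lexB_sound (v w : List ℕ) (h : lexB v w = true) : lexLtS (fl v) (fl w) := by
  unfold lexB at h
  simp only [Bool.or_eq_true, Bool.and_eq_true, Nat.blt_eq, Nat.beq_eq] at h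
  rcases h with h | ⟨h0, h | ⟨h1, h | ⟨h2, h⟩⟩⟩
  · exact ⟨0, by intro j hj; exact absurd hj (by simp), h⟩
  · refine ⟨1, ?_, h⟩
    intro j hj
    fin_cases j
    · exact h0
    all_goals exact absurd hj (by decide)
  · refine ⟨2, ?_, h⟩
    intro j hj
    fin_cases j
    · exact h0
    · exact h1
    all_goals exact absurd hj (by decide)
  · refine ⟨3, ?_, h⟩
    intro j hj
    fin_cases j
    · exact h0
    · exact h1
    · exact h2
    all_goals exact absurd hj (by decide)

def ltW (v w : List ℕ) : ℕ → ℕ → Bool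
  | 0, t => bdL v (2 ^ t) && bdL w (2 ^ t) && lexB v w
  | f + 1, t => Nat.blt (wtL v t) (wtL w t) || (Nat.beq (wtL v t) (wtL w t) && ltW v w f (t + 1))

theorem ltW_sound (v w : List ℕ) (f : ℕ) : ∀ t, (∀ j, j < t → wVec (fl v) j = wVec (fl w) j) →
    ltW v w f t = true → monLt (fl v) (fl w) := by
  induction f with
  | zero =>
    intro t ht h
    simp only [ltW, Bool.and_eq_true, bdL_iff] at h
    right
    refine ⟨?_, lexB_sound _ _ h.2⟩
    funext j
    by_cases hj : j < t
    · exact ht j hj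
    · rw [wVec_zero_of_lt _ t h.1.1 j (by omega), wVec_zero_of_lt _ t h.1.2 j (by omega)]
  | succ f ih =>
    intro t ht h
    simp only [ltW, Bool.or_eq_true, Bool.and_eq_true, Nat.blt_eq, Nat.beq_eq] at h
    rcases h with h | ⟨h1, h2⟩
    · left
      exact ⟨t, ht, by rw [wVec_fl, wVec_fl]; exact h⟩
    · apply ih (t + 1) _ h2
      intro j hj
      rcases Nat.lt_succ_iff_lt_or_eq.1 hj with hj | rfl
      · exact ht j hj
      · rw [wVec_fl, wVec_fl]; exact h1

def ltB (v w : List ℕ) : Bool := Nat.beq (smL v) (smL w) && ltW v w 7 0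

theorem ltB_sound (v w : List ℕ) (h : ltB v w = true) : (mono (fl v) : P 4) ∈ LowM (fl w) := by
  simp only [ltB, Bool.and_eq_true, Nat.beq_eq] at h
  apply Submodule.subset_span
  exact ⟨_, by rw [degA_fl, degA_fl, h.1], ltW_sound _ _ _ 0 (by intro j hj; omega) h.2, rfl⟩

def eqL : List ℕ → List ℕ → Bool
  | [], [] => true
  | a :: as, b :: bs => Nat.beq a b && eqL as bs
  | _, _ => false

theorem eqL_sound : ∀ (a b : List ℕ), eqL a b = true → a = b
  | [], [], _ => rfl
  | a :: as, b :: bs, h => by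
    simp only [eqL, Bool.and_eq_true, Nat.beq_eq] at h
    rw [h.1, eqL_sound as bs h.2]
  | [], _ :: _, h => by simp [eqL] at h
  | _ :: _, [], h => by simp [eqL] at h

def tog (x : List ℕ) : List (List ℕ) → List (List ℕ)
  | [] => [x]
  | y :: ys => bif eqL x y then ys else y :: tog x ys

def mfl (l : List ℕ) : P 4 := mono (fl l)

theorem add_self_P {n : ℕ} (x : P n) : x + x = 0 := CharTwo.add_self_eq_zero x

theorem tog_sum (x : List ℕ) (l : List (List ℕ)) :
    ((tog x l).map mfl).sum = mfl x + (l.map mfl).sum := by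
  induction l with
  | nil => simp [tog]
  | cons y ys ih =>
    unfold tog
    cases h : eqL x y
    · simp only [cond_false, List.map_cons, List.sum_cons, ih]; ring
    · rw [eqL_sound _ _ h]
      simp only [cond_true, List.map_cons, List.sum_cons]
      rw [← add_assoc, add_self_P, zero_add]

def red (w : List ℕ) : List (List ℕ) → List (List ℕ)
  | [] => []
  | x :: xs => bif ltB x w then red w xs else tog x (red w xs)

theorem red_sound (w : List ℕ) (l : List (List ℕ)) :
    (l.map mfl).sum - ((red w l).map mfl).sum ∈ LowM (fl w) := by
  induction l with
  | nil => simp [red]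
  | cons x xs ih =>
    unfold red
    cases h : ltB x w
    · simp only [cond_false, List.map_cons, List.sum_cons, tog_sum]
      convert ih using 1; ring
    · simp only [cond_true, List.map_cons, List.sum_cons]
      rw [add_sub_assoc]
      exact Submodule.add_mem _ (ltB_sound _ _ h) ih

def addL (h p : List ℕ) : List ℕ :=
  [h.getD 0 0 + p.getD 0 0, h.getD 1 0 + p.getD 1 0, h.getD 2 0 + p.getD 2 0, h.getD 3 0 + p.getD 3 0]

theorem fl_addL (h p : List ℕ) : fl (addL h p) = fl h + fl p := by
  ext j
  rw [Finsupp.add_apply]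
  fin_cases j <;> rfl

def allT (cert : List (ℕ × List ℕ)) : List (List ℕ) :=
  cert.flatMap fun e => (termsL e.1 e.2).map (addL e.2)

def len4 : List ℕ → Bool
  | [_, _, _, _] => true
  | _ => false

theorem len4_sound (l : List ℕ) (h : len4 l = true) : ∃ a b c d, l = [a, b, c, d] := by
  unfold len4 at h
  split at h
  · exact ⟨_, _, _, _, rfl⟩
  · simp at h

/-- A rule: block length, block, certificate. -/
abbrev Rule := ℕ × List ℕ × List (ℕ × List ℕ)

def isOne (w : List ℕ) : List (List ℕ) → Bool
  | [x] => eqL x w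
  | _ => false

def checkRule (R : Rule) : Bool :=
  bdL R.2.1 (2 ^ R.1) &&
  (R.2.2.all fun e => Nat.ble 1 e.1 && Nat.blt e.1 (2 ^ R.1) && len4 e.2 &&
    Nat.beq (smL e.2 + e.1) (smL R.2.1)) &&
  isOne R.2.1 (red R.2.1 (allT R.2.2))

theorem rule_sound (R : Rule) (h : checkRule R = true) (x z : Fin 4 →₀ ℕ) (r : ℕ)
    (hx : ∀ j, x j < 2 ^ r) : ¬ Admissible (emb x z r R.1 (fl R.2.1)) := by
  obtain ⟨s, w, cert⟩ := R
  simp only [checkRule, Bool.and_eq_true, List.all_eq_true, bdL_iff, Nat.ble_eq, Nat.blt_eq,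
    Nat.beq_eq] at h
  obtain ⟨⟨hw, hc⟩, h1⟩ := h
  refine strict_inadm x z r s (fl w) (cert.map fun e => (e.1, fl e.2)) hx hw ?_ ?_
  · intro e he
    rw [List.mem_map] at he
    obtain ⟨e, he, rfl⟩ := he
    obtain ⟨⟨⟨a1, a2⟩, _⟩, a4⟩ := hc e he
    exact ⟨a1, a2, by rw [degA_fl, degA_fl]; exact a4⟩
  · have e1 : ∀ l, isOne w l = true → (l.map mfl).sum = mono (fl w) := by
      intro l hl
      unfold isOne at hl
      split at hl
      · rw [eqL_sound _ _ hl]; simp [mfl]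
      · simp at hl
    have h2 := red_sound w (allT cert)
    rw [e1 _ h1] at h2
    convert h2 using 2
    clear h2 h1
    induction cert with
    | nil => simp [allT]
    | cons e es ih =>
      rw [List.map_cons, List.map_cons, List.sum_cons, ih (fun e he => hc e (List.mem_cons_of_mem _ he))]
      unfold allT
      rw [List.flatMap_cons, List.map_append, List.sum_append]
      congr 1
      obtain ⟨⟨_, a3⟩, _⟩ := hc e List.mem_cons_self
      obtain ⟨i, h⟩ := e
      obtain ⟨a, b, c, d, rfl⟩ := len4_sound _ a3
      simp only
      rw [← sum_termsL, List.map_map]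
      congr 1
      apply List.map_congr_left
      intro p _
      simp only [Function.comp, mfl, fl_addL]

/-! ### Part 4: data and search -/

def rules : List Rule := [
  (2,[0,0,0,2],[(1,[0,0,0,1])]),
  (2,[0,0,2,0],[(1,[0,0,1,0])]),
  (2,[0,0,2,2],[(1,[0,0,1,2])]),
  (2,[0,2,0,0],[(1,[0,1,0,0])]),
  (2,[0,2,0,2],[(1,[0,2,0,1])]),
  (2,[0,2,2,0],[(1,[0,1,2,0])]),
  (2,[2,0,0,0],[(1,[1,0,0,0])]),
  (2,[2,0,0,2],[(2,[1,0,0,1])]),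
  (2,[2,0,2,0],[(1,[2,0,1,0])]),
  (2,[2,2,0,0],[(2,[1,1,0,0])]),
  (2,[2,2,2,2],[(1,[2,2,1,2])]),
  (2,[0,0,2,1],[(1,[0,0,1,1])]),
  (2,[0,0,2,3],[(1,[0,0,1,3])]),
  (2,[0,2,0,1],[(1,[0,1,0,1])]),
  (2,[0,2,0,3],[(1,[0,1,0,3])]),
  (2,[0,2,2,1],[(1,[0,2,1,1])]),
  (2,[0,2,2,3],[(1,[0,2,1,3])]),
  (2,[2,0,0,1],[(1,[1,0,0,1])]),
  (2,[2,0,0,3],[(1,[1,0,0,3])]),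
  (2,[2,0,2,1],[(1,[2,0,1,1])]),
  (2,[2,0,2,3],[(1,[1,0,2,3])]),
  (2,[2,2,0,1],[(2,[1,1,0,1])]),
  (2,[2,2,0,3],[(1,[1,2,0,3])]),
  (2,[2,2,2,1],[(1,[2,2,1,1])]),
  (2,[2,2,2,3],[(1,[1,2,2,3])]),
  (2,[0,0,3,2],[(1,[0,0,3,1])]),
  (2,[0,2,1,0],[(1,[0,1,1,0])]),
  (2,[0,2,1,2],[(1,[0,1,1,2])]),
  (2,[0,2,3,0],[(1,[0,1,3,0])]),
  (2,[0,2,3,2],[(1,[0,1,3,2])]),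
  (2,[2,0,1,0],[(1,[1,0,1,0])]),
  (2,[2,0,1,2],[(1,[1,0,1,2])]),
  (2,[2,0,3,0],[(1,[1,0,3,0])]),
  (2,[2,0,3,2],[(1,[2,0,3,1])]),
  (2,[2,2,1,0],[(1,[2,1,1,0])]),
  (2,[2,2,1,2],[(1,[1,2,1,2])]),
  (2,[2,2,3,0],[(1,[1,2,3,0])]),
  (2,[2,2,3,2],[(1,[2,1,3,2])]),
  (2,[0,2,1,1],[(1,[0,1,1,1])]),
  (2,[0,2,3,3],[(1,[0,1,3,3])]),
  (2,[2,0,1,1],[(1,[1,0,1,1])]),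
  (2,[2,0,3,3],[(1,[1,0,3,3])]),
  (2,[2,2,1,3],[(1,[2,1,1,3])]),
  (2,[2,2,3,1],[(1,[1,2,3,1])]),
  (2,[0,1,2,2],[(1,[0,2,1,1]),(2,[0,1,1,1])]),
  (2,[0,3,0,2],[(1,[0,3,0,1])]),
  (2,[0,3,2,0],[(1,[0,3,1,0])]),
  (2,[0,3,2,2],[(1,[0,3,1,2])]),
  (2,[2,1,0,0],[(1,[1,1,0,0])]),
  (2,[2,1,0,2],[(1,[1,1,0,2])]),
  (2,[2,1,2,0],[(1,[1,1,2,0])]),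
  (2,[2,1,2,2],[(1,[1,1,2,2])]),
  (2,[2,3,0,0],[(1,[1,3,0,0])]),
  (2,[2,3,0,2],[(1,[1,3,0,2])]),
  (2,[2,3,2,0],[(1,[1,3,2,0])]),
  (2,[2,3,2,2],[(1,[2,3,2,1])]),
  (2,[0,3,2,3],[(1,[0,3,1,3])]),
  (2,[2,1,0,1],[(1,[1,1,0,1])]),
  (2,[2,1,2,3],[(1,[1,1,2,3])]),
  (2,[2,3,0,3],[(1,[1,3,0,3])]),
  (2,[2,3,2,1],[(1,[2,3,1,1])]),
  (2,[0,3,3,2],[(1,[0,3,3,1])]),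
  (2,[2,1,1,0],[(1,[1,1,1,0])]),
  (2,[2,1,3,2],[(1,[1,1,3,2])]),
  (2,[2,3,1,2],[(1,[1,3,1,2])]),
  (2,[2,3,3,0],[(1,[1,3,3,0])]),
  (2,[2,1,1,1],[(1,[1,1,1,1])]),
  (2,[2,1,1,3],[(1,[1,1,1,3])]),
  (2,[2,1,3,1],[(1,[1,1,3,1])]),
  (2,[2,1,3,3],[(1,[1,1,3,3])]),
  (2,[2,3,1,1],[(1,[1,3,1,1])]),
  (2,[2,3,1,3],[(1,[1,3,1,3])]),
  (2,[2,3,3,1],[(1,[1,3,3,1])]),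
  (2,[2,3,3,3],[(1,[1,3,3,3])]),
  (2,[1,0,2,2],[(1,[2,0,1,1]),(2,[1,0,1,1])]),
  (2,[1,2,0,2],[(1,[2,1,0,1]),(2,[1,1,0,1])]),
  (2,[1,2,2,0],[(1,[2,1,1,0]),(2,[1,1,1,0])]),
  (2,[3,0,0,2],[(1,[3,0,0,1])]),
  (2,[3,0,2,0],[(1,[3,0,1,0])]),
  (2,[3,0,2,2],[(1,[3,0,1,2])]),
  (2,[3,2,0,0],[(1,[3,1,0,0])]),
  (2,[3,2,0,2],[(1,[3,1,0,2])]),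
  (2,[3,2,2,0],[(1,[3,2,1,0])]),
  (2,[3,2,2,2],[(1,[3,1,2,2])]),
  (2,[3,0,2,3],[(1,[3,0,1,3])]),
  (2,[3,2,0,3],[(1,[3,1,0,3])]),
  (2,[3,2,2,1],[(1,[3,2,1,1])]),
  (2,[3,0,3,2],[(1,[3,0,3,1])]),
  (2,[3,2,1,2],[(1,[3,1,1,2])]),
  (2,[3,2,3,0],[(1,[3,1,3,0])]),
  (2,[3,2,1,1],[(1,[3,1,1,1])]),
  (2,[3,2,3,3],[(1,[3,1,3,3])]),
  (2,[3,3,0,2],[(1,[3,3,0,1])]),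
  (2,[3,3,2,0],[(1,[3,3,1,0])]),
  (2,[3,3,2,3],[(1,[3,3,1,3])]),
  (2,[3,3,3,2],[(1,[3,3,3,1])]),
  (3,[0,0,3,4],[(1,[0,0,3,3]),(2,[0,0,2,3])]),
  (3,[0,3,0,4],[(2,[0,2,0,3]),(1,[0,3,0,3])]),
  (3,[0,3,4,0],[(1,[0,3,3,0]),(2,[0,2,3,0])]),
  (3,[1,2,2,6],[(1,[2,1,1,6]),(4,[1,1,1,4]),(2,[1,1,1,6])]),
  (3,[1,2,6,2],[(4,[1,1,4,1]),(1,[2,1,6,1]),(2,[1,1,6,1])]),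
  (3,[1,6,2,2],[(4,[1,4,1,1]),(1,[2,6,1,1]),(2,[1,6,1,1])]),
  (3,[1,6,6,6],[(1,[4,6,5,3]),(1,[1,6,6,5]),(2,[2,6,6,3])]),
  (3,[3,0,0,4],[(2,[2,0,0,3]),(1,[3,0,0,3])]),
  (3,[3,0,4,0],[(2,[2,0,3,0]),(1,[3,0,3,0])]),
  (3,[3,4,0,0],[(2,[2,3,0,0]),(1,[3,3,0,0])]),
  (3,[3,4,4,4],[(2,[2,4,3,4]),(1,[3,4,3,4])]),
  (3,[3,4,4,5],[(2,[6,1,2,5]),(2,[3,1,4,6]),(2,[3,2,4,5]),(1,[5,1,4,5])]),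
  (3,[3,4,5,4],[(2,[6,4,3,1]),(2,[5,2,6,1]),(2,[3,4,5,2]),(1,[5,4,5,1])]),
  (3,[3,4,5,7],[(1,[3,1,3,11]),(2,[5,2,3,7]),(4,[3,2,3,7])]),
  (3,[3,4,7,5],[(1,[3,1,11,3]),(2,[5,2,7,3]),(4,[3,2,7,3])]),
  (3,[3,5,4,4],[(2,[6,5,2,1]),(2,[3,6,4,1]),(2,[3,5,4,2]),(1,[5,5,4,1])]),
  (3,[3,5,4,7],[(2,[5,3,2,7]),(1,[3,3,1,11]),(4,[3,3,2,7])]),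
  (3,[3,5,6,5],[(2,[5,3,6,3]),(1,[3,3,9,3]),(4,[3,3,6,3])]),
  (3,[3,7,4,5],[(2,[5,7,2,3]),(1,[3,11,1,3]),(4,[3,7,2,3])]),
  (3,[7,3,4,5],[(2,[7,5,2,3]),(1,[11,3,1,3]),(4,[7,3,2,3])]),
  (3,[3,5,5,6],[(2,[5,3,3,6]),(1,[3,3,3,9]),(4,[3,3,3,6])]),
  (3,[3,5,7,4],[(1,[3,3,11,1]),(2,[5,3,7,2]),(4,[3,3,7,2])]),
  (3,[3,7,5,4],[(1,[3,11,3,1]),(2,[5,7,3,2]),(4,[3,7,3,2])]),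
  (3,[7,3,5,4],[(1,[11,3,3,1]),(2,[7,5,3,2]),(4,[7,3,3,2])]),
  (4,[0,3,4,9],[(2,[0,2,1,11]),(1,[0,3,1,11]),(2,[0,5,2,7]),(4,[0,3,2,7])]),
  (4,[0,3,12,1],[(2,[0,3,7,4]),(2,[0,2,11,1]),(2,[0,3,9,2]),(4,[0,3,7,2]),(1,[0,3,11,1])]),
  (4,[0,3,5,8],[(2,[0,3,3,8]),(2,[0,2,3,9]),(1,[0,3,3,9]),(2,[0,3,5,6]),(4,[0,3,3,6])]),
  (4,[3,0,4,9],[(2,[2,0,1,11]),(2,[5,0,2,7]),(1,[3,0,1,11]),(4,[3,0,2,7])]),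
  (4,[3,0,12,1],[(2,[5,0,7,2]),(2,[2,0,11,1]),(1,[3,0,11,1]),(4,[3,0,7,2])]),
  (4,[3,4,0,9],[(2,[2,1,0,11]),(1,[3,1,0,11]),(2,[5,2,0,7]),(4,[3,2,0,7])]),
  (4,[3,4,8,1],[(2,[2,1,10,1]),(2,[3,1,8,2]),(4,[4,1,6,1]),(1,[5,1,8,1]),(2,[3,2,8,1]),(2,[6,1,6,1])]),
  (4,[3,12,0,1],[(2,[2,11,0,1]),(2,[5,7,0,2]),(4,[3,7,0,2]),(1,[3,11,0,1])]),
  (4,[3,0,5,8],[(2,[2,0,3,9]),(2,[5,0,3,6]),(1,[3,0,3,9]),(4,[3,0,3,6])]),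
  (4,[3,4,1,8],[(2,[3,1,2,8]),(2,[2,1,1,10]),(2,[6,1,1,6]),(2,[3,2,1,8]),(4,[4,1,1,6]),(1,[5,1,1,8])]),
  (4,[3,4,9,0],[(2,[2,1,11,0]),(2,[5,2,7,0]),(1,[3,1,11,0]),(4,[3,2,7,0])]),
  (4,[3,12,1,0],[(2,[3,7,4,0]),(2,[2,11,1,0]),(2,[3,9,2,0]),(4,[3,7,2,0]),(1,[3,11,1,0])]),
  (4,[3,5,0,8],[(2,[2,3,0,9]),(2,[5,3,0,6]),(1,[3,3,0,9]),(4,[3,3,0,6])]),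
  (4,[3,5,8,0],[(2,[2,3,9,0]),(2,[5,3,6,0]),(1,[3,3,9,0]),(4,[3,3,6,0])]),
  (5,[3,4,9,19],[(2,[3,2,3,25]),(2,[3,1,10,19]),(2,[3,1,3,26]),(2,[2,1,3,27]),(4,[4,1,3,23]),(4,[6,1,5,19]),(4,[6,1,3,21]),(2,[3,2,9,19]),(1,[5,1,3,25]),(1,[5,1,9,19]),(4,[12,1,3,15]),(8,[8,1,3,15]),(2,[10,1,3,19])]),
  (5,[3,4,25,3],[(2,[3,1,26,3]),(4,[6,1,19,5]),(2,[3,1,19,10]),(2,[2,1,27,3]),(4,[12,1,15,3]),(4,[6,1,21,3]),(4,[4,1,23,3]),(2,[3,2,19,9]),(2,[3,2,25,3]),(1,[5,1,19,9]),(2,[10,1,19,3]),(8,[8,1,15,3]),(1,[5,1,25,3])]),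
  (5,[3,28,1,3],[(2,[2,27,1,3]),(2,[3,25,2,3]),(4,[3,15,4,9]),(2,[3,23,1,6]),(2,[3,26,1,3]),(2,[6,23,1,3]),(1,[5,25,1,3]),(2,[3,23,2,5]),(8,[3,15,4,5]),(1,[5,23,1,5]),(4,[4,23,1,3])]),
  (5,[3,4,11,17],[(2,[3,1,10,19]),(2,[2,1,11,19]),(2,[3,1,7,22]),(4,[5,2,5,19]),(4,[4,1,7,19]),(2,[3,2,7,21]),(4,[6,1,5,19]),(4,[5,1,6,19]),(2,[3,2,9,19]),(4,[3,8,7,13]),(1,[9,1,5,19]),(1,[5,1,7,21]),(2,[6,1,7,19]),(8,[3,4,7,13])]),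
  (5,[3,28,3,1],[(2,[3,25,3,2]),(2,[2,27,3,1]),(2,[3,23,5,2]),(2,[3,23,6,1]),(4,[3,15,9,4]),(1,[5,23,5,1]),(2,[6,23,3,1]),(1,[5,25,3,1]),(8,[3,15,5,4]),(4,[4,23,3,1]),(2,[3,26,3,1])]),
  (5,[3,5,8,19],[(2,[3,3,2,25]),(2,[3,3,1,26]),(4,[3,4,1,23]),(4,[3,5,2,21]),(4,[3,5,4,19]),(8,[5,9,2,11]),(4,[4,3,1,23]),(1,[3,5,1,25]),(2,[2,3,1,27]),(8,[3,9,4,11]),(8,[3,9,2,13]),(4,[5,5,2,19]),(4,[5,9,2,15]),(1,[5,5,1,23]),(1,[5,3,1,25]),(2,[3,17,2,11]),(2,[6,3,1,23]),(8,[5,5,2,15]),(2,[3,6,1,23])]),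
  (5,[3,5,24,3],[(2,[2,3,25,3]),(4,[3,4,21,3]),(2,[3,3,22,5]),(4,[3,5,18,5]),(4,[3,5,14,9]),(1,[5,5,21,3]),(2,[3,5,22,3]),(2,[3,3,21,6]),(8,[3,5,14,5]),(4,[4,3,21,3]),(2,[6,3,21,3]),(1,[5,3,21,5]),(1,[3,5,21,5]),(2,[3,6,21,3])]),
  (5,[3,5,10,17],[(4,[3,4,5,19]),(4,[3,4,3,21]),(2,[2,9,3,19]),(1,[3,5,9,17]),(2,[3,5,6,19]),(2,[3,5,3,22]),(1,[5,5,3,21]),(4,[3,10,5,13]),(4,[4,5,3,19]),(2,[3,6,3,21]),(2,[6,5,3,19]),(1,[5,5,5,19]),(1,[3,5,5,21]),(2,[3,6,5,19]),(8,[3,6,5,13])]),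
  (5,[3,7,8,17],[(4,[3,5,1,22]),(4,[3,4,1,23]),(4,[3,5,4,19]),(4,[5,9,2,15]),(8,[3,12,1,11]),(4,[3,7,8,13]),(4,[4,7,1,19]),(2,[2,11,1,19]),(4,[6,9,1,15]),(4,[3,12,1,15]),(8,[5,10,1,11]),(8,[3,10,1,13]),(4,[3,7,4,17]),(4,[3,6,1,21]),(2,[3,7,1,22]),(8,[3,8,1,15]),(1,[9,9,1,15]),(4,[5,6,1,19]),(4,[9,6,1,15]),(2,[3,9,2,19]),(2,[3,18,1,11]),(1,[5,7,1,21]),(2,[3,7,2,21]),(2,[6,7,1,19]),(8,[3,7,4,13])]),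
  (5,[3,7,24,1],[(4,[3,5,19,4]),(4,[3,7,17,4]),(4,[3,6,21,1]),(4,[3,4,23,1]),(4,[3,7,13,8]),(4,[6,9,15,1]),(4,[4,7,19,1]),(2,[2,11,19,1]),(4,[3,5,22,1]),(4,[9,5,15,2]),(4,[3,12,15,1]),(4,[5,10,15,1]),(2,[3,7,21,2]),(2,[6,7,19,1]),(4,[5,5,19,2]),(2,[3,9,19,2]),(8,[3,7,13,4]),(2,[3,10,19,1]),(1,[5,7,21,1]),(1,[9,9,15,1]),(2,[3,7,22,1]),(8,[3,8,15,1])]),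
  (5,[7,3,8,17],[(4,[5,6,1,19]),(4,[5,2,1,23]),(4,[7,3,8,13]),(2,[7,2,1,23]),(4,[5,3,1,22]),(4,[5,3,2,21]),(4,[7,3,4,17]),(4,[11,4,1,15]),(2,[7,3,1,22]),(1,[7,5,1,21]),(2,[7,3,2,21]),(2,[7,6,1,19]),(8,[7,4,1,15]),(8,[7,3,4,13])]),
  (5,[7,3,24,1],[(4,[5,5,19,2]),(4,[5,3,22,1]),(4,[5,6,19,1]),(4,[5,3,19,4]),(4,[7,8,15,1]),(4,[5,2,23,1]),(4,[7,2,21,1]),(4,[11,3,13,4]),(4,[11,4,15,1]),(8,[9,2,15,1]),(2,[7,3,22,1]),(8,[7,3,13,4]),(4,[13,2,15,1]),(2,[7,5,19,2]),(2,[11,2,19,1]),(2,[7,6,19,1]),(1,[7,5,21,1]),(2,[7,3,19,4])]),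
  (5,[3,5,9,18],[(2,[2,3,3,25]),(4,[3,4,3,21]),(4,[6,17,3,5]),(8,[10,5,3,9]),(8,[3,5,10,9]),(4,[3,12,3,13]),(4,[12,3,3,13]),(4,[14,9,3,5]),(4,[3,5,3,20]),(8,[10,9,3,5]),(8,[3,9,10,5]),(8,[8,3,3,13]),(8,[3,12,3,9]),(4,[4,3,3,21]),(2,[3,3,9,18]),(4,[3,5,18,5]),(1,[3,17,5,9]),(2,[3,17,3,10]),(4,[14,5,3,9]),(2,[3,18,3,9]),(8,[3,9,3,12]),(1,[5,3,9,17]),(4,[3,17,6,5]),(2,[10,3,3,17]),(1,[5,17,3,9]),(2,[3,3,10,17]),(4,[6,3,5,17]),(8,[3,8,3,13])]),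
  (5,[3,5,25,2],[(4,[3,4,23,1]),(4,[3,5,19,4]),(4,[3,5,22,1]),(4,[3,5,15,8]),(2,[3,3,23,4]),(4,[3,6,21,1]),(2,[2,3,27,1]),(2,[3,3,26,1]),(4,[3,5,21,2]),(4,[4,3,23,1]),(1,[5,3,25,1]),(1,[3,9,21,1]),(2,[3,6,23,1]),(2,[6,3,23,1]),(1,[5,5,23,1]),(2,[5,3,23,2]),(8,[3,5,15,4])]),
  (5,[3,5,11,16],[(2,[2,3,19,9]),(4,[3,4,19,5]),(4,[4,3,15,9]),(8,[3,5,9,10]),(4,[9,5,7,10]),(4,[8,3,15,5]),(4,[3,5,19,4]),(4,[3,9,7,12]),(4,[3,5,13,10]),(8,[3,9,11,4]),(4,[9,9,7,6]),(4,[3,17,7,4]),(1,[5,3,21,5]),(2,[3,3,22,5]),(8,[3,9,7,8]),(8,[3,5,11,8]),(1,[3,5,21,5]),(2,[3,3,21,6]),(1,[5,5,19,5]),(2,[6,3,19,5]),(2,[3,9,11,10]),(2,[3,6,19,5]),(8,[5,5,11,6])]),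
  (5,[3,7,9,16],[(2,[3,3,10,17]),(2,[2,3,3,25]),(4,[4,19,3,5]),(8,[6,9,3,9]),(4,[3,18,5,5]),(4,[6,13,3,9]),(4,[6,5,3,17]),(4,[3,7,12,9]),(8,[3,7,8,9]),(2,[3,3,9,18]),(4,[6,3,5,17]),(4,[4,3,3,21]),(4,[3,6,5,17]),(4,[6,11,5,9]),(8,[3,10,5,9]),(2,[2,19,3,9]),(4,[3,7,9,12]),(1,[5,11,9,9]),(8,[8,3,3,13]),(4,[3,14,9,5]),(2,[3,11,10,9]),(4,[12,11,3,5]),(1,[5,3,9,17]),(4,[12,3,3,13]),(2,[10,3,3,17]),(1,[3,13,9,9]),(2,[10,11,3,9]),(8,[8,11,3,5]),(2,[3,11,9,10])]),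
  (5,[7,3,9,16],[(4,[7,2,13,9]),(4,[5,2,21,3]),(4,[6,17,5,3]),(8,[7,3,8,9]),(4,[7,6,9,9]),(4,[17,4,7,3]),(8,[10,3,9,5]),(8,[9,9,6,3]),(8,[10,9,5,3]),(4,[7,10,9,5]),(4,[11,4,11,5]),(4,[14,3,9,5]),(4,[5,17,6,3]),(4,[6,3,17,5]),(4,[7,4,17,3]),(4,[13,2,11,5]),(4,[7,3,12,9]),(4,[13,8,7,3]),(4,[7,12,9,3]),(8,[7,8,9,3]),(4,[13,10,5,3]),(2,[17,2,11,3]),(8,[9,2,13,3]),(4,[7,3,9,12]),(2,[11,8,11,3]),(2,[11,3,9,10]),(4,[11,4,13,3]),(1,[17,9,5,3]),(2,[11,2,11,9]),(1,[11,5,9,9]),(1,[13,3,9,9]),(2,[11,10,9,3]),(2,[11,3,10,9])])]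

def triD : List (List ℕ × List (ℕ × ℕ × ℕ)) := [
  ([1,0,3,63],[(8,4,0)]), ([0,1,3,63],[(8,4,1)]), ([1,3,0,63],[(8,2,0)]), ([0,3,1,63],[(8,2,2)]),
  ([3,1,0,63],[(8,1,1)]), ([3,0,1,63],[(8,1,2)]), ([1,1,2,63],[(8,5,1)]), ([1,2,1,63],[(8,3,2)]),
  ([1,0,63,3],[(4,8,0)]), ([0,1,63,3],[(4,8,1)]), ([1,3,63,0],[(4,2,0)]), ([0,3,63,1],[(4,2,3)]),
  ([3,1,63,0],[(4,1,1)]), ([3,0,63,1],[(4,1,3)]), ([1,1,63,2],[(4,9,1)]), ([1,2,63,1],[(4,3,3)]),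
  ([1,0,7,59],[(12,8,0)]), ([0,1,7,59],[(12,8,1)]), ([1,63,0,3],[(2,8,0)]), ([0,63,1,3],[(2,8,2)]),
  ([1,63,3,0],[(2,4,0)]), ([0,63,3,1],[(2,4,3)]), ([3,63,1,0],[(2,1,2)]), ([3,63,0,1],[(2,1,3)]),
  ([1,63,1,2],[(2,9,2)]), ([1,63,2,1],[(2,5,3)]), ([1,7,0,59],[(10,8,0)]), ([0,7,1,59],[(10,8,2)]),
  ([0,3,61,3],[(6,8,1)]), ([1,7,59,0],[(6,4,0)]), ([0,7,59,1],[(6,4,3)]), ([0,3,5,59],[(14,8,1)]),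
  ([63,1,0,3],[(1,8,1)]), ([63,0,1,3],[(1,8,2)]), ([63,1,3,0],[(1,4,1)]), ([63,0,3,1],[(1,4,3)]),
  ([63,3,1,0],[(1,2,2)]), ([63,3,0,1],[(1,2,3)]), ([63,1,1,2],[(1,10,2)]), ([63,1,2,1],[(1,6,3)]),
  ([7,1,0,59],[(9,8,1)]), ([7,0,1,59],[(9,8,2)]), ([3,0,61,3],[(5,8,0)]), ([7,1,59,0],[(5,4,1)]),
  ([7,0,59,1],[(5,4,3)]), ([3,0,5,59],[(13,8,0)]), ([3,61,0,3],[(3,8,0)]), ([1,62,1,3],[(3,8,2)]),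
  ([3,61,3,0],[(3,4,0)]), ([1,62,3,1],[(3,4,3)]), ([7,59,1,0],[(3,2,2)]), ([7,59,0,1],[(3,2,3)]),
  ([3,61,1,2],[(3,10,2)]), ([3,61,2,1],[(3,6,3)]), ([3,5,0,59],[(11,8,0)]), ([1,2,61,3],[(7,8,2)]),
  ([3,5,59,0],[(7,4,0)]), ([0,7,3,57],[(12,2,2),(14,4,1)]), ([0,3,3,61],[(10,4,1)]),
  ([0,3,7,57],[(14,4,1)]), ([7,0,3,57],[(12,1,2),(13,4,0)]), ([3,0,3,61],[(9,4,0)]),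
  ([3,0,7,57],[(13,4,0)]), ([7,3,0,57],[(10,1,1),(11,2,0)]), ([3,3,0,61],[(9,2,0)]),
  ([3,7,0,57],[(11,2,0)]), ([3,1,60,3],[(6,8,0),(7,8,0)]), ([1,1,62,3],[(5,8,1)]),
  ([1,3,60,3],[(7,8,0)]), ([1,3,61,2],[(6,1,1),(6,9,1)]), ([7,3,57,0],[(6,1,1),(7,2,0)]),
  ([3,3,61,0],[(5,2,0)]), ([3,1,61,2],[(5,10,0)]), ([3,7,57,0],[(7,2,0)]), ([1,6,59,1],[(7,10,2)]),
  ([3,4,59,1],[(7,14,2)]), ([3,3,60,1],[(6,12,0),(7,2,3)]), ([1,3,62,1],[(5,2,3)]),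
  ([1,7,58,1],[(7,2,3)]), ([7,1,58,1],[(6,1,3),(7,12,0)]), ([3,1,62,1],[(5,12,1)]),
  ([3,5,58,1],[(7,12,0)]), ([7,1,2,57],[(14,1,3),(15,14,3)]), ([3,1,2,61],[(9,6,0)]),
  ([1,3,4,59],[(13,8,1),(15,8,1)]), ([1,7,2,57],[(13,2,3),(15,2,3)]), ([1,3,2,61],[(10,5,1)]),
  ([1,2,5,59],[(11,8,2),(15,8,2)]), ([1,2,7,57],[(11,4,3),(15,4,3)]), ([1,2,3,61],[(12,3,2)]),
  ([3,1,6,57],[(14,5,3),(13,10,1),(11,14,3)]), ([1,1,6,59],[(13,2,3),(13,6,3)]),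
  ([1,6,1,59],[(14,8,0)]), ([3,1,4,59],[(13,8,1)]), ([3,4,1,59],[(11,8,2)]),
  ([3,5,2,57],[(11,4,3),(11,6,3)]), ([1,3,7,56],[(9,4,1),(13,4,1),(11,4,1),(15,4,1)]),
  ([1,1,7,58],[(10,4,0),(14,4,0)]), ([1,1,3,62],[(12,2,0),(12,10,0)]),
  ([3,1,7,56],[(9,4,1),(13,4,1)]), ([3,1,5,58],[(9,12,1),(13,12,1)]),
  ([3,3,5,56],[(10,4,0),(11,10,2),(15,10,0)]), ([1,3,5,58],[(10,12,0),(14,1,2),(14,13,2)]),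
  ([1,3,3,60],[(9,2,2),(13,2,2)]), ([1,3,6,57],[(11,12,1),(15,12,0)]), ([1,3,1,62],[(12,2,0)]),
  ([3,3,4,57],[(13,2,3)]), ([3,4,3,57],[(15,6,0)]), ([1,6,3,57],[(14,5,3)]),
  ([1,7,3,56],[(10,4,0)]), ([1,7,1,58],[(10,12,0)]), ([3,5,3,56],[(9,4,1),(11,4,0)]),
  ([3,1,3,60],[(10,1,2),(14,1,1)]), ([3,1,1,62],[(12,1,1)]), ([7,1,3,56],[(9,4,1)]),
  ([7,1,1,58],[(9,12,1)]), ([3,5,1,58],[(11,12,0)]), ([7,3,1,56],[(10,1,2),(11,2,2)]),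
  ([3,3,1,60],[(9,2,2)]), ([3,7,1,56],[(11,2,2)])]

def LL : List (List ℕ) := triD.map Prod.fst

theorem rules_ok : rules.all checkRule = true := by decide +kernel


def keys : List (ℕ × ℕ × List ℕ) := [
  (2,0,[
    524288, 8192, 532480, 128, 524416, 8320, 2, 524290, 8194, 130, 532610, 270336, 794624, 262272,
    786560, 270464, 794752, 262146, 786434, 270338, 794626, 262274, 786562, 270466, 794754, 536576,
    4224, 528512, 12416, 536704, 4098, 528386, 12290, 536578, 4226, 528514, 12418, 536706, 266368,
    798848, 266242, 798722, 790658, 274562, 532544, 524480, 8384, 532672, 66, 524354, 8258, 532546,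
    194, 524482, 8386, 532674, 794816, 262210, 794690, 786626, 270530, 536768, 4162, 536642, 528578,
    12482, 266306, 790594, 274498, 798786, 266434, 790722, 274626, 798914, 532481, 524417, 8321,
    524291, 8195, 532483, 131, 524419, 8323, 532611, 794627, 786563, 270467, 536579, 528515, 12419,
    266371, 798851, 524483, 8387, 794819, 536771]),
  (3,96,[
    1060864, 1048768, 16576, 1581185, 548993, 532865, 1597825, 1048579, 16387, 259, 1065219,
    1327363, 1069315, 1855747, 1339651, 1065283, 1851715, 1335619, 1327555, 1327303, 1593667,
    1077571, 1069507, 1069255]),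
  (4,120,[
    2375872, 311488, 2117824, 2375683, 311299, 2359555, 295171, 262915, 2117635, 2101507, 37123,
    4867, 2097475, 33091]),
  (5,134,[
    5017859, 889091, 792323, 4501763, 276227, 5013827, 885059, 4497731, 4489667, 360899, 4489415,
    360647, 4755779, 627011, 4239683, 4231619, 4231367])]

def codeL (q : ℕ) (p : List ℕ) : ℕ :=
  p.getD 0 0 / q + 64 * (p.getD 1 0 / q) + 4096 * (p.getD 2 0 / q) + 262144 * (p.getD 3 0 / q)

def findK (c : ℕ) : List ℕ → ℕ → ℕ
  | [], _ => 1000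
  | k :: ks, i => bif Nat.beq c k then i else findK c ks (i + 1)

def chkR (r : ℕ) (p : List ℕ) : Option Rule → Bool
  | none => false
  | some R => Nat.ble R.1 r && eqL (p.map fun x => x / 2 ^ (r - R.1)) R.2.1

def matchR (r : ℕ) (p : List ℕ) : Bool :=
  keys.any fun K => Nat.ble K.1 r && chkR r p (rules[findK (codeL (2 ^ (r - K.1)) p) K.2.2 K.2.1]?)

def letters : List (List ℕ) :=
  [[0,0,0,0],[0,0,0,1],[0,0,1,0],[0,0,1,1],[0,1,0,0],[0,1,0,1],[0,1,1,0],[0,1,1,1],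
   [1,0,0,0],[1,0,0,1],[1,0,1,0],[1,0,1,1],[1,1,0,0],[1,1,0,1],[1,1,1,0],[1,1,1,1]]

def stepL (q : ℕ) : List ℕ → List ℕ → List ℕ
  | a :: as, b :: bs => (a + q * b) :: stepL q as bs
  | _, _ => []

def search : ℕ → ℕ → List ℕ → ℕ → Bool
  | 0, _, _, _ => false
  | f + 1, r, p, rem => matchR r p || bif Nat.beq rem 0 then LL.any (eqL p) else
      letters.all fun l => bif Nat.ble (smL l) rem && Nat.beq ((rem - smL l) % 2) 0 then
        search f (r + 1) (stepL (2 ^ r) p l) ((rem - smL l) / 2) else true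

theorem search_ok : search 9 0 [0,0,0,0] 67 = true := by decide +kernel

def toL (a : Fin 4 →₀ ℕ) : List ℕ := [a 0, a 1, a 2, a 3]

theorem fl_toL (a : Fin 4 →₀ ℕ) : fl (toL a) = a := by
  ext j
  fin_cases j <;> rfl

theorem letters_mem (b0 b1 b2 b3 : ℕ) (h0 : b0 < 2) (h1 : b1 < 2) (h2 : b2 < 2) (h3 : b3 < 2) :
    [b0, b1, b2, b3] ∈ letters := by
  have e : ∀ b, b < 2 → b = 0 ∨ b = 1 := by intro b hb; omega
  rcases e _ h0 with rfl | rfl <;> rcases e _ h1 with rfl | rfl <;>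
  rcases e _ h2 with rfl | rfl <;> rcases e _ h3 with rfl | rfl <;> simp [letters]

theorem search_sound (a : Fin 4 →₀ ℕ) (f : ℕ) : ∀ (r : ℕ) (p : List ℕ) (rem : ℕ),
    p = [a 0 % 2 ^ r, a 1 % 2 ^ r, a 2 % 2 ^ r, a 3 % 2 ^ r] →
    rem = a 0 / 2 ^ r + a 1 / 2 ^ r + a 2 / 2 ^ r + a 3 / 2 ^ r →
    search f r p rem = true →
    toL a ∈ LL ∨ ∃ R ∈ rules, ∃ r', ∀ j, a j / 2 ^ r' % 2 ^ R.1 = fl R.2.1 j := by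
  induction f with
  | zero => intro r p rem _ _ h; simp [search] at h
  | succ f ih =>
    intro r p rem hp hrem h
    unfold search at h
    rw [Bool.or_eq_true] at h
    rcases h with h | h
    · right
      unfold matchR at h
      rw [List.any_eq_true] at h
      obtain ⟨K, _, h⟩ := h
      rw [Bool.and_eq_true] at h
      obtain ⟨_, h⟩ := h
      cases hg : rules[findK (codeL (2 ^ (r - K.1)) p) K.2.2 K.2.1]? with
      | none => rw [hg] at h; simp [chkR] at h
      | some R =>
      rw [hg] at h
      have hR : R ∈ rules := List.mem_of_getElem? hg
      unfold chkR at h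
      rw [Bool.and_eq_true, Nat.ble_eq] at h
      refine ⟨R, hR, r - R.1, ?_⟩
      have hq := eqL_sound _ _ h.2
      rw [hp] at hq
      have e : 2 ^ r = 2 ^ (r - R.1) * 2 ^ R.1 := by
        rw [← pow_add]; congr 1; omega
      intro j
      rw [← hq, ← Nat.mod_mul_right_div_self, ← e]
      fin_cases j <;> rfl
    · have h2 : 0 < 2 ^ r := by positivity
      cases hr : Nat.beq rem 0
      · rw [hr, cond_false, List.all_eq_true] at h
        obtain ⟨c0, hc0⟩ : ∃ c, c = a 0 / 2 ^ r := ⟨_, rfl⟩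
        obtain ⟨c1, hc1⟩ : ∃ c, c = a 1 / 2 ^ r := ⟨_, rfl⟩
        obtain ⟨c2, hc2⟩ : ∃ c, c = a 2 / 2 ^ r := ⟨_, rfl⟩
        obtain ⟨c3, hc3⟩ : ∃ c, c = a 3 / 2 ^ r := ⟨_, rfl⟩
        rw [← hc0, ← hc1, ← hc2, ← hc3] at hrem
        have hm := h [c0 % 2, c1 % 2, c2 % 2, c3 % 2]
          (letters_mem _ _ _ _ (by omega) (by omega) (by omega) (by omega))
        have hs : smL [c0 % 2, c1 % 2, c2 % 2, c3 % 2] = c0 % 2 + c1 % 2 + c2 % 2 + c3 % 2 := rfl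
        rw [hs] at hm
        have b1 : Nat.ble (c0 % 2 + c1 % 2 + c2 % 2 + c3 % 2) rem = true := by
          rw [Nat.ble_eq]; omega
        have b2 : Nat.beq ((rem - (c0 % 2 + c1 % 2 + c2 % 2 + c3 % 2)) % 2) 0 = true := by
          rw [Nat.beq_eq]; omega
        rw [b1, b2, Bool.and_self, cond_true] at hm
        refine ih _ _ _ ?_ ?_ hm
        · rw [hp]
          simp only [stepL, Nat.mod_pow_succ, hc0, hc1, hc2, hc3]
        · simp only [pow_succ, ← Nat.div_div_eq_div_mul, ← hc0, ← hc1, ← hc2, ← hc3]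
          omega
      · rw [hr, cond_true, List.any_eq_true] at h
        rw [Nat.beq_eq] at hr
        obtain ⟨q, hq, h⟩ := h
        left
        have := eqL_sound _ _ h
        rw [← this, hp] at hq
        have hz : ∀ x y z w : ℕ, 0 = x + y + z + w → x = 0 ∧ y = 0 ∧ z = 0 ∧ w = 0 := by omega
        rw [hr] at hrem
        obtain ⟨z0, z1, z2, z3⟩ := hz _ _ _ _ hrem
        rw [Nat.div_eq_zero_iff_lt h2] at z0 z1 z2 z3
        rw [Nat.mod_eq_of_lt z0, Nat.mod_eq_of_lt z1, Nat.mod_eq_of_lt z2, Nat.mod_eq_of_lt z3] at hq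
        exact hq

theorem adm_mem_LL (a : Fin 4 →₀ ℕ) (hd : degA a = 67) (ha : Admissible a) : toL a ∈ LL := by
  have hd' : a 0 + a 1 + a 2 + a 3 = 67 := by
    rw [← hd]; unfold degA; rw [Fin.sum_univ_four]
  rcases search_sound a 9 0 [0,0,0,0] 67 (by simp [Nat.mod_one]) (by simp; omega) search_ok with h | h
  · exact h
  · exfalso
    obtain ⟨R, hR, r, h⟩ := h
    have hck := List.all_eq_true.1 rules_ok R hR
    refine rule_sound R hck (Finsupp.equivFunOnFinite.symm fun j => a j % 2 ^ r)
      (Finsupp.equivFunOnFinite.symm fun j => a j / 2 ^ r / 2 ^ R.1) r ?_ ?_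
    · intro j
      exact Nat.mod_lt _ (by positivity)
    · convert ha
      ext j
      rw [emb_apply, ← h j]
      change a j % 2 ^ r + 2 ^ r * (a j / 2 ^ r % 2 ^ R.1 + 2 ^ R.1 * (a j / 2 ^ r / 2 ^ R.1)) = a j
      rw [Nat.mod_add_div, Nat.mod_add_div]

/-! ### Part 5: functionals vanishing on hits -/

theorem homComp_of_hom {m n : ℕ} (g : P m →ₐ[ZMod 2] P n)
    (hg : ∀ j, (g (X j)).IsHomogeneous 1) {f : P m} {d : ℕ} (hf : f.IsHomogeneous d) :
    (g f).IsHomogeneous d := by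
  have : g = aeval fun j => g (X j) := by
    apply MvPolynomial.algHom_ext
    intro j; simp
  rw [this]
  have := hf.aeval (fun j => g (X j)) (n := 1) hg
  simpa using this

theorem homComp_map {m n : ℕ} (g : P m →ₐ[ZMod 2] P n)
    (hg : ∀ j, (g (X j)).IsHomogeneous 1) (f : P m) (d : ℕ) :
    homogeneousComponent d (g f) = g (homogeneousComponent d f) := by
  conv_lhs => rw [← sum_homogeneousComponent f]
  rw [map_sum, map_sum]
  have h : ∀ k, homogeneousComponent d (g (homogeneousComponent k f))
      = if k = d then g (homogeneousComponent d f) else 0 := by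
    intro k
    rw [homogeneousComponent_of_mem ((mem_homogeneousSubmodule _ _).2
      (homComp_of_hom g hg (homogeneousComponent_isHomogeneous k f)))]
    split_ifs with h1 h2 h2
    · rw [h1]
    · exact absurd h1.symm h2
    · exact absurd h2.symm h1
    · rfl
  rw [Finset.sum_congr rfl fun k _ => h k, Finset.sum_ite_eq']
  split_ifs with hd
  · rfl
  · rw [Finset.mem_range, not_lt] at hd
    rw [homogeneousComponent_eq_zero _ _ (by omega)]
    simp

theorem hit_map {m n : ℕ} (g : P m →ₐ[ZMod 2] P n)
    (hg : ∀ j, (g (X j)).IsHomogeneous 1)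
    (hs : ∀ j, SqT n (g (X j)) = g (X j) + g (X j) ^ 2) {d : ℕ} {u : P m} (hu : u ∈ hitSub m d) :
    g u ∈ hitSub n d := by
  have hcomm : ∀ f, SqT n (g f) = g (SqT m f) := by
    intro f
    have : (SqT n).comp g = g.comp (SqT m) := by
      apply MvPolynomial.algHom_ext
      intro j
      simp [SqT]
      simp [← hs j, SqT]
    exact DFunLike.congr_fun this f
  rw [mem_hitSub] at hu ⊢
  obtain ⟨f, hf, rfl⟩ := hu
  refine ⟨fun i => g (f i), ?_, ?_⟩
  · intro i
    rw [mem_homogeneousSubmodule]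
    exact homComp_of_hom g hg ((mem_homogeneousSubmodule _ _).1 (hf i))
  · rw [map_sum]
    apply Finset.sum_congr rfl
    intro i _
    rw [hcomm, homComp_map g hg]

theorem pderiv_SqT {n : ℕ} (j : Fin n) (f : P n) : pderiv j (SqT n f) = SqT n (pderiv j f) := by
  induction f using MvPolynomial.induction_on with
  | C a => simp [SqT]
  | add p q hp hq => simp [hp, hq]
  | mul_X p k hp =>
    have h2 : (2 : P n) = 0 := CharTwo.two_eq_zero
    have hX : SqT n (X k) = X k + X k ^ 2 := by simp [SqT]
    have hd : pderiv j (X k + X k ^ 2 : P n) = pderiv j (X k) := by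
      rw [map_add, pderiv_pow]
      simp [h2]
    have hc : SqT n (pderiv j (X k)) = pderiv j (X k) := by
      rw [pderiv_X]
      by_cases h : k = j
      · subst h; simp
      · simp [Ne.symm h]
    rw [map_mul, pderiv_mul, pderiv_mul, hp, hX, hd, map_add, map_mul, map_mul, hX, hc]

theorem homComp_pderiv {n : ℕ} (j : Fin n) (f : P n) (d : ℕ) :
    homogeneousComponent d (pderiv j f) = pderiv j (homogeneousComponent (d + 1) f) := by
  induction f using MvPolynomial.induction_on' with
  | add p q hp hq => simp [hp, hq]
  | monomial s a =>
    have hm : ∀ (s : Fin n →₀ ℕ) (a : ZMod 2) (d : ℕ), homogeneousComponent d (monomial s a : P n)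
        = if degA s = d then monomial s a else 0 := by
      intro s a d
      have : (monomial s a : P n) = a • mono s := by simp [mono, smul_monomial]
      rw [this, map_smul, homComp_mono]
      split_ifs <;> simp
    rw [pderiv_monomial, hm, hm]
    by_cases hs : s j = 0
    · simp only [hs, Nat.cast_zero, mul_zero, monomial_zero, ite_self]
      split_ifs
      · rw [pderiv_monomial, hs]; simp
      · simp
    · have hdeg : degA (s - Finsupp.single j 1) + 1 = degA s := by
        have e : s - Finsupp.single j 1 + Finsupp.single j 1 = s := by
          apply tsub_add_cancel_of_le
          rw [Finsupp.single_le_iff]; omega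
        have h1 : degA (Finsupp.single j 1 : Fin n →₀ ℕ) = 1 := by
          simp [degA, Finsupp.single_apply]
        have h3 := congrArg degA e
        rw [degA_add, h1] at h3
        exact h3
      by_cases h : degA (s - Finsupp.single j 1) = d
      · rw [if_pos h, if_pos (by omega), pderiv_monomial]
      · rw [if_neg h, if_neg (by omega)]; simp

theorem hit_pderiv {n d : ℕ} (j : Fin n) {u : P n} (hu : u ∈ hitSub n (d + 1)) :
    pderiv j u ∈ hitSub n d := by
  rw [mem_hitSub] at hu
  obtain ⟨f, hf, rfl⟩ := hu
  rw [map_sum]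
  apply Submodule.sum_mem
  intro i hi
  rw [Finset.mem_Icc] at hi
  rw [← homComp_pderiv, pderiv_SqT]
  have hfi := (mem_homogeneousSubmodule _ _).1 (hf i)
  by_cases hid : i ≤ d
  · rw [mem_hitSub]
    apply isHit_single hi.1 hid
    rw [mem_homogeneousSubmodule]
    have := hfi.pderiv (i := j)
    have e : d + 1 - i - 1 = d - i := by omega
    rwa [e] at this
  · have e : d + 1 - i = 0 := by omega
    rw [e] at hfi
    have h0 : f i = C (coeff 0 (f i)) := by
      rw [← homogeneousComponent_zero, homogeneousComponent_of_mem ((mem_homogeneousSubmodule _ _).2 hfi)]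
      simp
    rw [h0, pderiv_C]
    simp

/-- The spike exponent. -/
def spk : Fin 2 →₀ ℕ := Finsupp.equivFunOnFinite.symm ![63, 3]

theorem spike_hit {u : P 2} (hu : u ∈ hitSub 2 66) : coeff spk u = 0 := by
  rw [mem_hitSub] at hu
  obtain ⟨f, hf, rfl⟩ := hu
  rw [coeff_sum]
  apply Finset.sum_eq_zero
  intro i hi
  rw [Finset.mem_Icc] at hi
  have hfi := (mem_homogeneousSubmodule _ _).1 (hf i)
  rw [coeff_homogeneousComponent]
  split_ifs
  swap
  · rfl
  have key : ∀ a : Fin 2 →₀ ℕ, degA a = 66 - i → coeff spk (SqT 2 (mono a)) = 0 := by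
    intro a ha
    rw [SqT_mono, coeff_sum]
    apply Finset.sum_eq_zero
    intro p hp
    rw [Fintype.mem_piFinset] at hp
    unfold mono
    rw [coeff_monomial, if_neg]
    intro he
    have h0 := hp 0
    have h1 := hp 1
    rw [mem_BB] at h0 h1
    have e0 := DFunLike.congr_fun he 0
    have e1 := DFunLike.congr_fun he 1
    simp only [Finsupp.add_apply, spk, Finsupp.equivFunOnFinite_symm_apply_apply,
      Matrix.cons_val_zero, Matrix.cons_val_one] at e0 e1
    have d0 : ∀ p, p < 64 → (63 - p) &&& p = p → p = 0 := by decide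
    have d1 : ∀ p, p < 4 → (3 - p) &&& p = p → p = 0 := by decide
    have z0 := d0 (p 0) (by omega) (by rw [← e0]; simpa using h0)
    have z1 := d1 (p 1) (by omega) (by rw [← e1]; simpa using h1)
    unfold degA at ha
    rw [Fin.sum_univ_two] at ha
    omega
  rw [(f i).as_sum, map_sum, coeff_sum]
  apply Finset.sum_eq_zero
  intro a ha
  have : (monomial a (coeff a (f i)) : P 2) = coeff a (f i) • mono a := by simp [mono, smul_monomial]
  rw [this, map_smul, coeff_smul, key a, smul_zero]
  have := hfi (mem_support_iff.1 ha)
  rw [← this]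
  simp [degA, Finsupp.weight_apply, Finsupp.sum_fintype]

def b2 (b : Bool) : ZMod 2 := if b then 1 else 0

/-- Substitution to two variables. -/
def gV (v1 v2 : ℕ) : P 4 →ₐ[ZMod 2] P 2 :=
  aeval fun k : Fin 4 => C (b2 (v1.testBit k)) * X 0 + C (b2 (v2.testBit k)) * X 1

def lamV (v1 v2 : ℕ) (j : Fin 4) (u : P 4) : ZMod 2 := coeff spk (gV v1 v2 (pderiv j u))

theorem b2_sq (b : Bool) : b2 b ^ 2 = b2 b := by cases b <;> simp [b2]

theorem lamV_hit (v1 v2 : ℕ) (j : Fin 4) {u : P 4} (hu : u ∈ hitSub 4 67) : lamV v1 v2 j u = 0 := by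
  apply spike_hit
  apply hit_map _ _ _ (hit_pderiv j hu)
  · intro k
    simp only [gV, aeval_X]
    apply IsHomogeneous.add
    · simpa using (isHomogeneous_C (Fin 2) (b2 (v1.testBit k))).mul (isHomogeneous_X (ZMod 2) (0 : Fin 2))
    · simpa using (isHomogeneous_C (Fin 2) (b2 (v2.testBit k))).mul (isHomogeneous_X (ZMod 2) (1 : Fin 2))
  · intro k
    simp only [gV, aeval_X]
    rw [CharTwo.add_sq, mul_pow, mul_pow, ← C_pow, ← C_pow, b2_sq, b2_sq]
    simp [SqT]
    ring

theorem lamV_sum (v1 v2 : ℕ) (j : Fin 4) (S : Finset (Fin 4 →₀ ℕ)) :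
    lamV v1 v2 j (∑ b ∈ S, mono b) = ∑ b ∈ S, lamV v1 v2 j (mono b) := by
  unfold lamV
  rw [map_sum, map_sum, coeff_sum]

/-- Dehomogenization. -/
def psi : P 2 →ₐ[ZMod 2] Polynomial (ZMod 2) := aeval ![1, Polynomial.X]

theorem psi_coeff {f : P 2} (hf : f.IsHomogeneous 66) : coeff spk f = (psi f).coeff 3 := by
  conv_rhs => rw [f.as_sum, map_sum, Polynomial.finsetSum_coeff]
  have h : ∀ e ∈ f.support, (psi (monomial e (coeff e f))).coeff 3 = if e = spk then coeff spk f else 0 := by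
    intro e he
    have hd := hf (mem_support_iff.1 he)
    have hd' : e 0 + e 1 = 66 := by
      rw [← hd]; simp [Finsupp.weight_apply, Finsupp.sum_fintype]
    have : psi (monomial e (coeff e f)) = Polynomial.C (coeff e f) * Polynomial.X ^ (e 1) := by
      unfold psi
      rw [aeval_monomial]
      simp [Finsupp.prod_fintype]
    rw [this, Polynomial.coeff_C_mul_X_pow]
    by_cases h : e = spk
    · rw [if_pos h, h]; simp [spk]
    · rw [if_neg h, if_neg]
      intro h3
      apply h
      ext k
      fin_cases k
      · simp [spk]; omega
      · simp [spk]; omega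
  rw [Finset.sum_congr rfl h, Finset.sum_ite_eq']
  split_ifs with hs
  · rfl
  · exact notMem_support_iff.1 hs

def stp (a b : Bool) (N : ℕ) : ℕ := (bif a then N else 0) ^^^ (bif b then 2 * N else 0)

def itB (a b : Bool) : ℕ → ℕ → ℕ
  | 0, N => N
  | n + 1, N => itB a b n (stp a b N)

def pw (a b : Bool) (r N : ℕ) : ℕ :=
  bif Nat.blt r 4 then itB a b r N else bif a then itB a b (r % 4) N else 0

def RepP (N : ℕ) (f : Polynomial (ZMod 2)) : Prop := ∀ i, i < 4 → f.coeff i = b2 (N.testBit i)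

def linP (a b : Bool) : Polynomial (ZMod 2) :=
  Polynomial.C (b2 a) + Polynomial.C (b2 b) * Polynomial.X

theorem b2_xor (x y : Bool) : b2 (x ^^ y) = b2 x + b2 y := by
  cases x <;> cases y <;> simp [b2]; decide

theorem rep_stp (a b : Bool) {N : ℕ} {f : Polynomial (ZMod 2)} (h : RepP N f) :
    RepP (stp a b N) (f * linP a b) := by
  intro i hi
  unfold stp linP
  rw [Nat.testBit_xor, b2_xor, mul_add, Polynomial.coeff_add, Polynomial.coeff_mul_C, ← mul_assoc]
  congr 1
  · rw [h i hi]
    cases a <;> simp [b2]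
  · cases i with
    | zero => cases b <;> simp [b2]
    | succ i =>
      rw [Polynomial.coeff_mul_X, Polynomial.coeff_mul_C, h i (by omega)]
      cases b
      · simp [b2]
      · simp [b2, Nat.testBit_succ]

theorem rep_itB (a b : Bool) (n : ℕ) : ∀ {N : ℕ} {f : Polynomial (ZMod 2)}, RepP N f →
    RepP (itB a b n N) (f * linP a b ^ n) := by
  induction n with
  | zero => intro N f h; simpa [itB] using h
  | succ n ih =>
    intro N f h
    have := ih (rep_stp a b h)
    rw [pow_succ', ← mul_assoc]
    exact this

theorem linP_four (a b : Bool) : linP a b ^ 4 =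
    Polynomial.C (b2 a) + Polynomial.C (b2 b) * Polynomial.X ^ 4 := by
  unfold linP
  have : ∀ x y : Polynomial (ZMod 2), (x + y) ^ 4 = x ^ 4 + y ^ 4 := by
    intro x y
    rw [show 4 = 2 * 2 from rfl, pow_mul, CharTwo.add_sq, CharTwo.add_sq, ← pow_mul, ← pow_mul]
  rw [this, mul_pow, ← Polynomial.C_pow, ← Polynomial.C_pow]
  cases a <;> cases b <;> simp [b2]

theorem rep_pw (a b : Bool) (r : ℕ) {N : ℕ} {f : Polynomial (ZMod 2)} (h : RepP N f) :
    RepP (pw a b r N) (f * linP a b ^ r) := by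
  unfold pw
  cases hr : Nat.blt r 4
  · have hr' : ¬ r < 4 := by
      intro hlt
      rw [← Nat.blt_eq, hr] at hlt
      exact absurd hlt (by simp)
    obtain ⟨q, hq⟩ : ∃ q, r = r % 4 + 4 * (q + 1) := ⟨r / 4 - 1, by omega⟩
    simp only [cond_false]
    rw [hq, pow_add, pow_mul, linP_four, ← mul_assoc]
    have e : (r % 4 + 4 * (q + 1)) % 4 = r % 4 := by omega
    rw [e]
    have h1 := rep_itB a b (r % 4) h
    set F := f * linP a b ^ (r % 4)
    cases a
    · simp only [cond_false]
      intro i hi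
      simp only [b2, Nat.zero_testBit]
      have : F * (Polynomial.C (if false = true then 1 else 0) + Polynomial.C (if b = true then 1 else 0) * Polynomial.X ^ 4) ^ (q + 1)
        = (F * (Polynomial.C (if b = true then 1 else 0) * Polynomial.X ^ 4) ^ q * Polynomial.C (if b = true then 1 else 0)) * Polynomial.X ^ 4 := by
        cases b
        · simp
        · simp; ring
      rw [this, Polynomial.coeff_mul_X_pow', if_neg (by omega)]
      simp
    · simp only [cond_true]
      generalize q + 1 = m
      have : ∀ m, RepP (itB true b (r % 4) N) (F * (Polynomial.C (b2 true) + Polynomial.C (b2 b) * Polynomial.X ^ 4) ^ m) := by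
        intro m
        induction m with
        | zero => simpa using h1
        | succ m ih =>
          intro i hi
          rw [← ih i hi, pow_succ, ← mul_assoc, mul_add, ← mul_assoc _ _ (Polynomial.X ^ 4),
            Polynomial.coeff_add, Polynomial.coeff_mul_X_pow', if_neg (by omega)]
          simp [b2]
      exact this m
  · simp only [cond_true]
    exact rep_itB a b r h

/-- Value of the functional on a monomial. -/
def lamB (V : ℕ × ℕ × ℕ) (m : List ℕ) : Bool :=
  (m.getD V.2.2 0).testBit 0 &&
  (pw (V.1.testBit 3) (V.2.1.testBit 3) (m.getD 3 0 - (Nat.beq V.2.2 3).toNat)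
  (pw (V.1.testBit 2) (V.2.1.testBit 2) (m.getD 2 0 - (Nat.beq V.2.2 2).toNat)
  (pw (V.1.testBit 1) (V.2.1.testBit 1) (m.getD 1 0 - (Nat.beq V.2.2 1).toNat)
  (pw (V.1.testBit 0) (V.2.1.testBit 0) (m.getD 0 0 - (Nat.beq V.2.2 0).toNat) 1)))).testBit 3

theorem lamB_sound (v1 v2 : ℕ) (j : Fin 4) (m : List ℕ) (hm : smL m = 67) :
    lamV v1 v2 j (mono (fl m)) = b2 (lamB (v1, v2, j) m) := by
  unfold lamV mono lamB
  rw [pderiv_monomial, one_mul]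
  have hfl : fl m j = m.getD j 0 := rfl
  have hodd : ((fl m j : ℕ) : ZMod 2) = b2 ((m.getD j 0).testBit 0) := by
    rw [hfl]
    rw [Nat.testBit_zero]
    rcases Nat.mod_two_eq_zero_or_one (m.getD j 0) with h | h
    · rw [(ZMod.natCast_eq_zero_iff _ _).2 (Nat.dvd_of_mod_eq_zero h), h]; simp [b2]
    · rw [ZMod.natCast_eq_one_iff_odd.2 (Nat.odd_iff.2 h), h]; simp [b2]
  rw [hodd]
  cases hb : (m.getD j 0).testBit 0
  · simp [b2]
  · rw [Bool.true_and]
    have e1 : b2 true = 1 := rfl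
    rw [e1]
    set r := fl m - Finsupp.single j 1 with hr
    have hpos : 1 ≤ fl m j := by
      rw [hfl]
      rcases Nat.eq_zero_or_pos (m.getD j 0) with h | h
      · rw [h] at hb; simp at hb
      · exact h
    have hdeg : degA r = 66 := by
      have e : r + Finsupp.single j 1 = fl m := by
        apply tsub_add_cancel_of_le
        rw [Finsupp.single_le_iff]; omega
      have h1 : degA (Finsupp.single j 1 : Fin 4 →₀ ℕ) = 1 := by
        simp [degA, Finsupp.single_apply]
      have h3 := congrArg degA e
      rw [degA_add, h1, degA_fl, hm] at h3
      omega
    have hhom : (gV v1 v2 (monomial r 1)).IsHomogeneous 66 := by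
      apply homComp_of_hom
      · intro k
        simp only [gV, aeval_X]
        apply IsHomogeneous.add
        · simpa using (isHomogeneous_C (Fin 2) (b2 (v1.testBit k))).mul (isHomogeneous_X (ZMod 2) (0 : Fin 2))
        · simpa using (isHomogeneous_C (Fin 2) (b2 (v2.testBit k))).mul (isHomogeneous_X (ZMod 2) (1 : Fin 2))
      · rw [← hdeg]; exact mono_hom r
    rw [psi_coeff hhom]
    have hprod : psi (gV v1 v2 (monomial r 1)) = 1 * linP (v1.testBit 0) (v2.testBit 0) ^ (r 0)
        * linP (v1.testBit 1) (v2.testBit 1) ^ (r 1) * linP (v1.testBit 2) (v2.testBit 2) ^ (r 2)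
        * linP (v1.testBit 3) (v2.testBit 3) ^ (r 3) := by
      unfold gV
      rw [aeval_monomial, Finsupp.prod_fintype _ _ (by simp), Fin.prod_univ_four]
      have hx : ∀ k : Fin 4, psi (C (b2 (v1.testBit k)) * X 0 + C (b2 (v2.testBit k)) * X 1)
          = linP (v1.testBit k) (v2.testBit k) := by
        intro k
        simp [psi, linP]
      simp only [map_mul, map_pow, map_one, hx, one_mul]
      rfl
    rw [hprod]
    have hrk : ∀ k : Fin 4, r k = m.getD k 0 - (Nat.beq j k).toNat := by
      intro k
      rw [hr, Finsupp.tsub_apply, fl_apply, Finsupp.single_apply]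
      congr 1
      by_cases h : j = k
      · subst h; simp
      · rw [if_neg h]
        have : Nat.beq (j : ℕ) (k : ℕ) = false := by
          rw [← Bool.not_eq_true, Nat.beq_eq]
          exact fun hh => h (Fin.ext hh)
        rw [this]; rfl
    have h1 : RepP 1 1 := by
      intro i hi
      interval_cases i <;> simp [b2, Polynomial.coeff_one] <;> decide
    have := rep_pw (v1.testBit 3) (v2.testBit 3) (r 3) (rep_pw (v1.testBit 2) (v2.testBit 2) (r 2)
      (rep_pw (v1.testBit 1) (v2.testBit 1) (r 1) (rep_pw (v1.testBit 0) (v2.testBit 0) (r 0) h1)))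
      3 (by norm_num)
    rw [this, hrk 0, hrk 1, hrk 2, hrk 3]
    rfl

def evB : List (ℕ × ℕ × ℕ) → List ℕ → Bool
  | [], _ => false
  | V :: Vs, m => lamB V m ^^ evB Vs m

def chkT : List (List ℕ × List (ℕ × ℕ × ℕ)) → Bool
  | [] => true
  | e :: t => (Nat.beq (smL e.1) 67 && e.2.all (fun V => Nat.blt V.2.2 4)) &&
      (evB e.2 e.1 && (t.all (fun x => bif evB e.2 x.1 then false else true) && chkT t))

/-- The functional attached to a list. -/
def evV (Vs : List (ℕ × ℕ × ℕ)) (u : P 4) : ZMod 2 :=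
  (Vs.map fun V => lamV V.1 V.2.1 (Fin.ofNat 4 V.2.2) u).sum

theorem evV_hit (Vs : List (ℕ × ℕ × ℕ)) {u : P 4} (hu : u ∈ hitSub 4 67) : evV Vs u = 0 := by
  induction Vs with
  | nil => rfl
  | cons V Vs ih =>
    unfold evV at ih ⊢
    rw [List.map_cons, List.sum_cons, ih, lamV_hit _ _ _ hu, add_zero]

theorem evV_sum (Vs : List (ℕ × ℕ × ℕ)) (S : Finset (Fin 4 →₀ ℕ)) :
    evV Vs (∑ b ∈ S, mono b) = ∑ b ∈ S, evV Vs (mono b) := by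
  induction Vs with
  | nil => simp [evV]
  | cons V Vs ih =>
    unfold evV at ih ⊢
    simp only [List.map_cons, List.sum_cons]
    rw [ih, lamV_sum, Finset.sum_add_distrib]

theorem evB_sound (Vs : List (ℕ × ℕ × ℕ)) (hV : ∀ V ∈ Vs, V.2.2 < 4) (m : List ℕ) (hm : smL m = 67) :
    evV Vs (mono (fl m)) = b2 (evB Vs m) := by
  induction Vs with
  | nil => rfl
  | cons V Vs ih =>
    have := ih fun V hV' => hV V (List.mem_cons_of_mem _ hV')
    unfold evV at this ⊢
    unfold evB
    rw [List.map_cons, List.sum_cons, this, b2_xor, lamB_sound _ _ _ _ hm]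
    have h4 := hV V List.mem_cons_self
    have : ((Fin.ofNat 4 V.2.2 : Fin 4) : ℕ) = V.2.2 := by
      simp [Fin.ofNat, Nat.mod_eq_of_lt h4]
    rw [this]

theorem chkT_deg (T : List (List ℕ × List (ℕ × ℕ × ℕ))) (h : chkT T = true) :
    ∀ e ∈ T, smL e.1 = 67 := by
  induction T with
  | nil => simp
  | cons e t ih =>
    simp only [chkT, Bool.and_eq_true, Nat.beq_eq] at h
    intro x hx
    rcases List.mem_cons.1 hx with rfl | hx
    · exact h.1.1
    · exact ih h.2.2.2 x hx

theorem indep (T : List (List ℕ × List (ℕ × ℕ × ℕ))) (h : chkT T = true) (S : Finset (Fin 4 →₀ ℕ))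
    (hS : ∀ b ∈ S, ∃ e ∈ T, b = fl e.1) (hh : ∑ b ∈ S, mono b ∈ hitSub 4 67) : S = ∅ := by
  classical
  induction T with
  | nil =>
    rw [Finset.eq_empty_iff_forall_notMem]
    intro b hb
    obtain ⟨e, he, _⟩ := hS b hb
    simp at he
  | cons e t ih =>
    have hdeg := chkT_deg _ h
    simp only [chkT, Bool.and_eq_true, Nat.beq_eq, List.all_eq_true, Nat.blt_eq] at h
    obtain ⟨⟨h1, h2⟩, h3, h4, h5⟩ := h
    apply ih h5
    intro b hb
    obtain ⟨x, hx, rfl⟩ := hS b hb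
    rcases List.mem_cons.1 hx with rfl | hx
    swap
    · exact ⟨x, hx, rfl⟩
    by_contra hcon
    have h0 := evV_hit x.2 hh
    rw [evV_sum, Finset.sum_eq_single (fl x.1)] at h0
    · rw [evB_sound _ h2 _ h1, h3] at h0
      exact absurd h0 (by decide)
    · intro c hc hne
      obtain ⟨y, hy, rfl⟩ := hS c hc
      rw [evB_sound _ h2 _ (hdeg y hy)]
      rcases List.mem_cons.1 hy with rfl | hy'
      · exact absurd rfl hne
      · have := h4 y hy'
        cases hE : evB x.2 y.1
        · rfl
        · rw [hE] at this; simp at this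
    · intro hn; exact absurd hb hn

theorem triD_ok : chkT triD = true := by decide +kernel

/-! ### Part 6: admissible monomials form a basis -/

theorem finite_deg (n d : ℕ) : Finite {a : Fin n →₀ ℕ // degA a = d} := by
  have hb : ∀ (a : {a : Fin n →₀ ℕ // degA a = d}) (j : Fin n), a.1 j < d + 1 := by
    intro a j
    have h1 : a.1 j ≤ ∑ i, a.1 i := Finset.single_le_sum (fun _ _ => Nat.zero_le _) (Finset.mem_univ j)
    have h2 := a.2
    unfold degA at h2
    omega
  refine Finite.of_injective
    (fun a : {a : Fin n →₀ ℕ // degA a = d} => fun j : Fin n => (⟨a.1 j, hb a j⟩ : Fin (d + 1))) ?_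
  intro a b h
  apply Subtype.ext
  ext j
  have := congrFun h j
  simpa using this

/-- Span of the admissible monomials. -/
def AdmSpan (n d : ℕ) : Submodule (ZMod 2) (P n) :=
  Submodule.span (ZMod 2) {x | ∃ b : Fin n →₀ ℕ, (degA b = d ∧ Admissible b) ∧ x = mono b}

theorem adm_reduce {n d : ℕ} (a : Fin n →₀ ℕ) (ha : degA a = d) :
    (mono a : P n) ∈ AdmSpan n d ⊔ hitSub n d := by
  have := finite_deg n d
  let rel : {a : Fin n →₀ ℕ // degA a = d} → {a : Fin n →₀ ℕ // degA a = d} → Prop :=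
    fun x y => okey x.1 < okey y.1
  have hT : IsTrans _ rel := ⟨fun _ _ _ h1 h2 => lt_trans h1 h2⟩
  have hI : Std.Irrefl rel := ⟨fun _ => lt_irrefl _⟩
  have hwf : WellFounded rel := Finite.wellFounded_of_trans_of_irrefl rel
  have main : ∀ x : {a : Fin n →₀ ℕ // degA a = d}, (mono x.1 : P n) ∈ AdmSpan n d ⊔ hitSub n d := by
    intro x
    induction x using hwf.induction with
    | _ x ih =>
      by_cases hx : Admissible x.1
      · exact Submodule.mem_sup_left (Submodule.subset_span ⟨x.1, ⟨x.2, hx⟩, rfl⟩)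
      · rw [not_adm_iff, x.2] at hx
        have hle : LowM x.1 ⊔ hitSub n d ≤ AdmSpan n d ⊔ hitSub n d := by
          apply sup_le _ le_sup_right
          unfold LowM
          rw [Submodule.span_le]
          rintro _ ⟨b, hb1, hb2, rfl⟩
          exact ih ⟨b, hb1.trans x.2⟩ ((monLt_iff _ _).1 hb2)
        exact hle hx
  exact main ⟨a, ha⟩

theorem adm_indep {n d : ℕ} (S : Finset (Fin n →₀ ℕ)) (hS : ∀ b ∈ S, degA b = d ∧ Admissible b)
    (hh : ∑ b ∈ S, mono b ∈ hitSub n d) : S = ∅ := by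
  classical
  by_contra hne
  obtain ⟨a, ha, hmax⟩ := S.exists_max_image okey (Finset.nonempty_iff_ne_empty.2 hne)
  have hna : ¬ Admissible a := by
    rw [not_adm_iff, (hS a ha).1]
    have h1 := Finset.add_sum_erase S (fun b => (mono b : P n)) ha
    have h2 : mono a = -∑ b ∈ S.erase a, (mono b : P n) + ∑ b ∈ S, mono b := by
      rw [← h1]; ring
    rw [h2]
    apply Submodule.add_mem_sup _ hh
    apply Submodule.neg_mem
    apply Submodule.sum_mem
    intro b hb
    rw [Finset.mem_erase] at hb
    apply Submodule.subset_span
    refine ⟨b, by rw [(hS a ha).1, (hS b hb.2).1], ?_, rfl⟩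
    rw [monLt_iff]
    exact lt_of_le_of_ne (hmax b hb.2) fun h => hb.1 (okey_inj h)
  exact hna (hS a ha).2

theorem LL_adm (q : List ℕ) (hq : q ∈ LL) : degA (fl q) = 67 ∧ Admissible (fl q) := by
  classical
  unfold LL at hq
  rw [List.mem_map] at hq
  obtain ⟨e, he, rfl⟩ := hq
  have hd : degA (fl e.1) = 67 := by rw [degA_fl]; exact chkT_deg _ triD_ok e he
  refine ⟨hd, ?_⟩
  by_contra hna
  have h := adm_reduce (fl e.1) hd
  rw [Submodule.mem_sup] at h
  obtain ⟨y, hy, z, hz, hyz⟩ := h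
  obtain ⟨S, hS, rfl⟩ := span_sum _ _ hy
  have hnot : fl e.1 ∉ S := fun hm => hna (hS _ hm).2
  have := indep triD triD_ok (insert (fl e.1) S) ?_ ?_
  · simp at this
  · intro b hb
    rcases Finset.mem_insert.1 hb with rfl | hb
    · exact ⟨e, he, rfl⟩
    · have := adm_mem_LL b (hS b hb).1 (hS b hb).2
      unfold LL at this
      rw [List.mem_map] at this
      obtain ⟨e', he', h⟩ := this
      exact ⟨e', he', by rw [h, fl_toL]⟩
  · rw [Finset.sum_insert hnot, ← hyz]
    rw [add_comm (∑ b ∈ S, mono b) z, add_assoc, add_self_P, add_zero]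
    exact hz

theorem LL_len : LL.all len4 = true := by decide +kernel

/-! ### Part 7: passage to five variables -/

/-- Insert a zero exponent at position `t`. -/
def ins (t : Fin 5) (a : Fin 4 →₀ ℕ) : Fin 5 →₀ ℕ :=
  Finsupp.equivFunOnFinite.symm (t.insertNth (α := fun _ => ℕ) 0 ⇑a)

theorem ins_same (t : Fin 5) (a : Fin 4 →₀ ℕ) : ins t a t = 0 := by
  simp [ins]

theorem ins_sA (t : Fin 5) (a : Fin 4 →₀ ℕ) (i : Fin 4) : ins t a (t.succAbove i) = a i := by
  simp [ins]

theorem ins_of_zero (t : Fin 5) (b : Fin 5 →₀ ℕ) (hb : b t = 0) :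
    b = ins t (Finsupp.equivFunOnFinite.symm fun i => b (t.succAbove i)) := by
  ext k
  revert k
  rw [Fin.forall_iff_succAbove t]
  refine ⟨by rw [ins_same, hb], fun i => by rw [ins_sA]; rfl⟩

theorem degA_ins (t : Fin 5) (a : Fin 4 →₀ ℕ) : degA (ins t a) = degA a := by
  unfold degA
  rw [Fin.sum_univ_succAbove _ t, ins_same, zero_add]
  exact Finset.sum_congr rfl fun i _ => ins_sA t a i

theorem wVec_ins (t : Fin 5) (a : Fin 4 →₀ ℕ) : wVec (ins t a) = wVec a := by
  funext s
  unfold wVec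
  rw [Fin.sum_univ_succAbove _ t, ins_same]
  simp only [ins_sA]
  simp

theorem monLt_of_ins (t : Fin 5) (a b : Fin 4 →₀ ℕ) (h : monLt (ins t a) (ins t b)) : monLt a b := by
  unfold monLt at h ⊢
  rw [wVec_ins, wVec_ins] at h
  rcases h with h | ⟨h1, i, hi, hlt⟩
  · exact Or.inl h
  · right
    refine ⟨h1, ?_⟩
    rcases Fin.eq_self_or_eq_succAbove t i with rfl | ⟨k, rfl⟩
    · rw [ins_same, ins_same] at hlt; omega
    · refine ⟨k, fun j hj => ?_, ?_⟩
      · have := hi (t.succAbove j) (Fin.strictMono_succAbove t hj)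
        rwa [ins_sA, ins_sA] at this
      · rwa [ins_sA, ins_sA] at hlt

theorem Tmap_mono (t : Fin 5) (a : Fin 4 →₀ ℕ) : Tmap t (mono a) = mono (ins t a) := by
  unfold Tmap mono
  rw [rename_monomial]
  have hf : (fun i : Fin 4 => if (i : ℕ) < (t : ℕ) then i.castSucc else i.succ) = t.succAbove := by
    funext i
    simp [Fin.succAbove, Fin.lt_def]
  rw [hf]
  have hm : Finsupp.mapDomain t.succAbove a = ins t a := by
    ext k
    revert k
    rw [Fin.forall_iff_succAbove t]
    refine ⟨?_, fun i => ?_⟩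
    · rw [ins_same, Finsupp.mapDomain_of_notMem_range]
      rintro ⟨i, hi⟩
      exact Fin.succAbove_ne t i hi
    · rw [ins_sA, Finsupp.mapDomain_apply Fin.succAbove_right_injective]
  rw [hm]

theorem hit_Tmap (t : Fin 5) {d : ℕ} {u : P 4} (hu : u ∈ hitSub 4 d) : Tmap t u ∈ hitSub 5 d := by
  apply hit_map _ _ _ hu
  · intro j
    rw [Tmap, rename_X]
    exact isHomogeneous_X _ _
  · intro j
    rw [Tmap, rename_X]
    simp [SqT]

/-- Projection killing `x_t`. -/
def prj (t : Fin 5) : P 5 →ₐ[ZMod 2] P 4 :=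
  aeval (t.insertNth (α := fun _ => P 4) 0 fun i => X i)

theorem hit_prj (t : Fin 5) {d : ℕ} {u : P 5} (hu : u ∈ hitSub 5 d) : prj t u ∈ hitSub 4 d := by
  apply hit_map _ _ _ hu
  · rw [Fin.forall_iff_succAbove t]
    refine ⟨?_, fun i => ?_⟩
    · rw [prj, aeval_X, Fin.insertNth_apply_same]
      exact isHomogeneous_zero _ _ _
    · rw [prj, aeval_X, Fin.insertNth_apply_succAbove]
      exact isHomogeneous_X _ _
  · rw [Fin.forall_iff_succAbove t]
    refine ⟨?_, fun i => ?_⟩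
    · rw [prj, aeval_X, Fin.insertNth_apply_same]
      simp
    · rw [prj, aeval_X, Fin.insertNth_apply_succAbove]
      simp [SqT]

theorem prj_ins (t : Fin 5) (a : Fin 4 →₀ ℕ) : prj t (mono (ins t a)) = mono a := by
  unfold prj mono
  rw [aeval_monomial, Finsupp.prod_fintype _ _ (by simp), Fin.prod_univ_succAbove _ t, ins_same]
  simp only [ins_sA, Fin.insertNth_apply_succAbove, pow_zero, one_mul, map_one]
  rw [monomial_eq, Finsupp.prod_fintype _ _ (by simp)]
  simp

theorem prj_zero (t : Fin 5) (b : Fin 5 →₀ ℕ) (hb : b t ≠ 0) : prj t (mono b) = 0 := by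
  unfold prj mono
  rw [aeval_monomial, Finsupp.prod_fintype _ _ (by simp), Fin.prod_univ_succAbove _ t,
    Fin.insertNth_apply_same, zero_pow hb]
  simp

theorem adm_ins (t : Fin 5) (a : Fin 4 →₀ ℕ) (ha : Admissible a) : Admissible (ins t a) := by
  by_contra h
  rw [not_adm_iff] at h
  revert ha
  change ¬ Admissible a
  rw [not_adm_iff]
  have hle : LowM (ins t a) ⊔ hitSub 5 (degA (ins t a)) ≤
      (LowM a ⊔ hitSub 4 (degA a)).comap (prj t).toLinearMap := by
    apply sup_le
    · unfold LowM
      rw [Submodule.span_le]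
      rintro _ ⟨b, hb1, hb2, rfl⟩
      change prj t (mono b) ∈ LowM a ⊔ hitSub 4 (degA a)
      by_cases hb : b t = 0
      · rw [ins_of_zero t b hb] at hb1 hb2 ⊢
        rw [prj_ins]
        rw [degA_ins, degA_ins] at hb1
        exact Submodule.mem_sup_left (Submodule.subset_span ⟨_, hb1, monLt_of_ins _ _ _ hb2, rfl⟩)
      · rw [prj_zero t b hb]; exact Submodule.zero_mem _
    · intro u hu
      rw [degA_ins] at hu
      exact Submodule.mem_sup_right (hit_prj t hu)
  have : prj t (mono (ins t a)) ∈ LowM a ⊔ hitSub 4 (degA a) := hle h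
  rwa [prj_ins] at this

/-- `cls` as a linear map. -/
def clsL (n d : ℕ) : P n →ₗ[ZMod 2] QP n d :=
  ((hitSub n d).comap (homSub n d).subtype).mkQ ∘ₗ
    (homogeneousComponent d).codRestrict (homSub n d) fun f =>
      (mem_homogeneousSubmodule _ _).2 (homogeneousComponent_isHomogeneous d f)

theorem cls_eq (n d : ℕ) (f : P n) : cls n d f = clsL n d f := rfl

theorem clsL_eq_zero (n d : ℕ) (f : P n) :
    clsL n d f = 0 ↔ homogeneousComponent d f ∈ hitSub n d := by
  unfold clsL
  rw [LinearMap.comp_apply, Submodule.mkQ_apply, Submodule.Quotient.mk_eq_zero, Submodule.mem_comap]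
  rfl

theorem hit_hom {n d : ℕ} {u : P n} (hu : u ∈ hitSub n d) : homogeneousComponent d u = u := by
  rw [mem_hitSub] at hu
  obtain ⟨f, _, rfl⟩ := hu
  rw [map_sum]
  apply Finset.sum_congr rfl
  intro i _
  rw [homogeneousComponent_of_mem ((mem_homogeneousSubmodule _ _).2
    (homogeneousComponent_isHomogeneous _ _)), if_pos rfl]

theorem clsL_hit {n d : ℕ} {u : P n} (hu : u ∈ hitSub n d) : clsL n d u = 0 := by
  rw [clsL_eq_zero, hit_hom hu]; exact hu

/-- The exponents of the `T_t(y)`. -/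
def EE : Set (Fin 5 →₀ ℕ) := {e | ∃ t : Fin 5, ∃ a, degA a = 67 ∧ Admissible a ∧ e = ins t a}

theorem EE_adm {e : Fin 5 →₀ ℕ} (he : e ∈ EE) : degA e = 67 ∧ Admissible e := by
  obtain ⟨t, a, h1, h2, rfl⟩ := he
  exact ⟨by rw [degA_ins, h1], adm_ins t a h2⟩

def vE (e : EE) : QP 5 67 := clsL 5 67 (mono e.1)

theorem Sset_eq : Sset = Set.range vE := by
  ext x
  constructor
  · rintro ⟨t, a, h1, h2, rfl⟩
    refine ⟨⟨ins t a, t, a, h1, h2, rfl⟩, ?_⟩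
    rw [Tmap_mono]; rfl
  · rintro ⟨⟨e, t, a, h1, h2, rfl⟩, rfl⟩
    exact ⟨t, a, h1, h2, by rw [Tmap_mono]; rfl⟩

theorem vE_indep : LinearIndependent (ZMod 2) vE := by
  classical
  rw [linearIndependent_iff']
  intro s g hg
  have hs : ∑ i ∈ s, g i • vE i = clsL 5 67 (∑ b ∈ (s.filter fun i => g i = 1).map
      (Function.Embedding.subtype _), mono b) := by
    rw [map_sum, Finset.sum_map, Finset.sum_filter]
    apply Finset.sum_congr rfl
    intro i _
    rcases zmod2_cases (g i) with h | h
    · rw [h]; simp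
    · rw [h]; simp [vE]
  rw [hs, clsL_eq_zero, map_sum] at hg
  have hS : ∀ b ∈ (s.filter fun i => g i = 1).map (Function.Embedding.subtype _),
      degA b = 67 ∧ Admissible b := by
    intro b hb
    rw [Finset.mem_map] at hb
    obtain ⟨e, _, rfl⟩ := hb
    exact EE_adm e.2
  rw [Finset.sum_congr rfl (fun b hb => by rw [homComp_mono, if_pos (hS b hb).1])] at hg
  have h0 := adm_indep _ hS hg
  intro i hi
  rcases zmod2_cases (g i) with h | h
  · exact h
  · exfalso
    rw [Finset.map_eq_empty, Finset.filter_eq_empty_iff] at h0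
    exact h0 hi h

theorem span_Sset : Submodule.span (ZMod 2) Sset = Qzero 5 67 := by
  apply le_antisymm
  · rw [Submodule.span_le]
    rintro _ ⟨t, a, h1, h2, rfl⟩
    rw [Tmap_mono]
    have hd : degA (ins t a) = 67 := by rw [degA_ins, h1]
    refine ⟨⟨homogeneousComponent 67 (mono (ins t a)), (mem_homogeneousSubmodule _ _).2
      (homogeneousComponent_isHomogeneous _ _)⟩, ?_, rfl⟩
    change homogeneousComponent 67 (mono (ins t a)) ∈ PzeroSub 5
    rw [homComp_mono, if_pos hd]
    exact Submodule.subset_span ⟨_, ⟨t, ins_same t a⟩, rfl⟩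
  · rintro _ ⟨x, hx, rfl⟩
    have hx' : (x : P 5) ∈ PzeroSub 5 := hx
    have e1 : ((hitSub 5 67).comap (homSub 5 67).subtype).mkQ x = clsL 5 67 (x : P 5) := by
      unfold clsL
      rw [LinearMap.comp_apply]
      congr 1
      apply Subtype.ext
      change (x : P 5) = homogeneousComponent 67 (x : P 5)
      rw [homogeneousComponent_of_mem x.2, if_pos rfl]
    rw [e1]
    have hle : PzeroSub 5 ≤ (Submodule.span (ZMod 2) Sset).comap (clsL 5 67) := by
      unfold PzeroSub
      rw [Submodule.span_le]
      rintro _ ⟨b, ⟨t, hb⟩, rfl⟩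
      change clsL 5 67 (mono b) ∈ Submodule.span (ZMod 2) Sset
      by_cases hd : degA b = 67
      · rw [ins_of_zero t b hb] at hd ⊢
        rw [degA_ins] at hd
        have h := adm_reduce _ hd
        rw [← Tmap_mono]
        have hle2 : AdmSpan 4 67 ⊔ hitSub 4 67 ≤
            (Submodule.span (ZMod 2) Sset).comap (clsL 5 67 ∘ₗ (Tmap t).toLinearMap) := by
          apply sup_le
          · unfold AdmSpan
            rw [Submodule.span_le]
            rintro _ ⟨c, ⟨hc1, hc2⟩, rfl⟩
            exact Submodule.subset_span ⟨t, c, hc1, hc2, rfl⟩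
          · intro u hu
            change clsL 5 67 (Tmap t u) ∈ Submodule.span (ZMod 2) Sset
            rw [clsL_hit (hit_Tmap t hu)]
            exact Submodule.zero_mem _
        exact hle2 h
      · have : clsL 5 67 (mono b) = 0 := by
          rw [clsL_eq_zero, homComp_mono, if_neg hd]
          exact Submodule.zero_mem _
        rw [this]; exact Submodule.zero_mem _
    exact hle hx'

/-! ### Part 8: counting -/

def codeI (q : List ℕ) : ℕ → ℕ
  | 0 => q.getD 0 0 * 128 + q.getD 1 0 * 16384 + q.getD 2 0 * 2097152 + q.getD 3 0 * 268435456
  | 1 => q.getD 0 0 + q.getD 1 0 * 16384 + q.getD 2 0 * 2097152 + q.getD 3 0 * 268435456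
  | 2 => q.getD 0 0 + q.getD 1 0 * 128 + q.getD 2 0 * 2097152 + q.getD 3 0 * 268435456
  | 3 => q.getD 0 0 + q.getD 1 0 * 128 + q.getD 2 0 * 16384 + q.getD 3 0 * 268435456
  | _ => q.getD 0 0 + q.getD 1 0 * 128 + q.getD 2 0 * 16384 + q.getD 3 0 * 2097152

def code5 (e : Fin 5 →₀ ℕ) : ℕ :=
  e 0 + e 1 * 128 + e 2 * 16384 + e 3 * 2097152 + e 4 * 268435456

theorem code5_ins (t : Fin 5) (q : List ℕ) : code5 (ins t (fl q)) = codeI q t := by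
  have h0 := ins_same t (fl q)
  have h1 := ins_sA t (fl q) 0
  have h2 := ins_sA t (fl q) 1
  have h3 := ins_sA t (fl q) 2
  have h4 := ins_sA t (fl q) 3
  rw [fl_apply] at h1 h2 h3 h4
  unfold code5
  fin_cases t
  · change ins 0 (fl q) 0 = 0 at h0
    change ins 0 (fl q) 1 = q.getD 0 0 at h1
    change ins 0 (fl q) 2 = q.getD 1 0 at h2
    change ins 0 (fl q) 3 = q.getD 2 0 at h3
    change ins 0 (fl q) 4 = q.getD 3 0 at h4
    change ins 0 (fl q) 0 + ins 0 (fl q) 1 * 128 + ins 0 (fl q) 2 * 16384 + ins 0 (fl q) 3 * 2097152 + ins 0 (fl q) 4 * 268435456 = codeI q 0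
    rw [h0, h1, h2, h3, h4, codeI]; ring
  · change ins 1 (fl q) 1 = 0 at h0
    change ins 1 (fl q) 0 = q.getD 0 0 at h1
    change ins 1 (fl q) 2 = q.getD 1 0 at h2
    change ins 1 (fl q) 3 = q.getD 2 0 at h3
    change ins 1 (fl q) 4 = q.getD 3 0 at h4
    change ins 1 (fl q) 0 + ins 1 (fl q) 1 * 128 + ins 1 (fl q) 2 * 16384 + ins 1 (fl q) 3 * 2097152 + ins 1 (fl q) 4 * 268435456 = codeI q 1
    rw [h0, h1, h2, h3, h4, codeI]; ring
  · change ins 2 (fl q) 2 = 0 at h0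
    change ins 2 (fl q) 0 = q.getD 0 0 at h1
    change ins 2 (fl q) 1 = q.getD 1 0 at h2
    change ins 2 (fl q) 3 = q.getD 2 0 at h3
    change ins 2 (fl q) 4 = q.getD 3 0 at h4
    change ins 2 (fl q) 0 + ins 2 (fl q) 1 * 128 + ins 2 (fl q) 2 * 16384 + ins 2 (fl q) 3 * 2097152 + ins 2 (fl q) 4 * 268435456 = codeI q 2
    rw [h0, h1, h2, h3, h4, codeI]; ring
  · change ins 3 (fl q) 3 = 0 at h0
    change ins 3 (fl q) 0 = q.getD 0 0 at h1
    change ins 3 (fl q) 1 = q.getD 1 0 at h2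
    change ins 3 (fl q) 2 = q.getD 2 0 at h3
    change ins 3 (fl q) 4 = q.getD 3 0 at h4
    change ins 3 (fl q) 0 + ins 3 (fl q) 1 * 128 + ins 3 (fl q) 2 * 16384 + ins 3 (fl q) 3 * 2097152 + ins 3 (fl q) 4 * 268435456 = codeI q 3
    rw [h0, h1, h2, h3, h4, codeI]; ring
  · change ins 4 (fl q) 4 = 0 at h0
    change ins 4 (fl q) 0 = q.getD 0 0 at h1
    change ins 4 (fl q) 1 = q.getD 1 0 at h2
    change ins 4 (fl q) 2 = q.getD 2 0 at h3
    change ins 4 (fl q) 3 = q.getD 3 0 at h4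
    change ins 4 (fl q) 0 + ins 4 (fl q) 1 * 128 + ins 4 (fl q) 2 * 16384 + ins 4 (fl q) 3 * 2097152 + ins 4 (fl q) 4 * 268435456 = codeI q 4
    rw [h0, h1, h2, h3, h4]
    simp only [codeI]; ring

def codes : List ℕ := [0, 1, 2, 3, 4].flatMap fun t => LL.map fun q => codeI q t

theorem code5_inj : Set.InjOn code5 EE := by
  intro e he f hf h
  have h1 := (EE_adm he).1
  have h2 := (EE_adm hf).1
  unfold degA at h1 h2
  rw [Fin.sum_univ_five] at h1 h2
  unfold code5 at h
  have k0 : e 0 = f 0 := by omega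
  rw [k0] at h
  have g1 : e 1 + e 2 * 128 + e 3 * 16384 + e 4 * 2097152 =
    f 1 + f 2 * 128 + f 3 * 16384 + f 4 * 2097152 := by omega
  have k1 : e 1 = f 1 := by omega
  rw [k1] at g1
  have g2 : e 2 + e 3 * 128 + e 4 * 16384 = f 2 + f 3 * 128 + f 4 * 16384 := by omega
  have k2 : e 2 = f 2 := by omega
  have g3 : e 3 + e 4 * 128 = f 3 + f 4 * 128 := by omega
  have k3 : e 3 = f 3 := by omega
  have k4 : e 4 = f 4 := by omega
  ext k
  fin_cases k
  · exact k0
  · exact k1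
  · exact k2
  · exact k3
  · exact k4

theorem code5_image : code5 '' EE = ↑codes.toFinset := by
  ext c
  rw [Finset.mem_coe, List.mem_toFinset]
  unfold codes
  simp only [List.mem_flatMap, List.mem_map]
  constructor
  · rintro ⟨e, ⟨t, a, h1, h2, rfl⟩, rfl⟩
    refine ⟨t, ?_, toL a, adm_mem_LL a h1 h2, ?_⟩
    · fin_cases t <;> simp
    · rw [← code5_ins, fl_toL]
  · rintro ⟨t, ht, q, hq, rfl⟩
    have ht5 : t < 5 := by
      simp at ht; omega
    have := LL_adm q hq
    exact ⟨_, ⟨⟨t, ht5⟩, fl q, this.1, this.2, rfl⟩, code5_ins ⟨t, ht5⟩ q⟩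

def memN (c : ℕ) : List ℕ → Bool
  | [] => false
  | k :: ks => Nat.beq c k || memN c ks

theorem memN_iff (c : ℕ) (l : List ℕ) : memN c l = true ↔ c ∈ l := by
  induction l with
  | nil => simp [memN]
  | cons k ks ih => simp [memN, ih]

def cntN : List ℕ → ℕ
  | [] => 0
  | k :: ks => bif memN k ks then cntN ks else cntN ks + 1

theorem cntN_eq (l : List ℕ) : l.toFinset.card = cntN l := by
  induction l with
  | nil => rfl
  | cons k ks ih =>
    unfold cntN
    rw [List.toFinset_cons]
    cases h : memN k ks
    · rw [Finset.card_insert_of_notMem, ih]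
      · rfl
      · rw [List.mem_toFinset, ← memN_iff, h]; simp
    · rw [Finset.insert_eq_of_mem, ih]
      · rfl
      · rw [List.mem_toFinset, ← memN_iff, h]

theorem cnt_ok : Nat.beq (cntN codes) 460 = true := by decide +kernel

theorem beq460 (x : ℕ) (h : Nat.beq x 460 = true) : x = 460 := Nat.eq_of_beq_eq_true h

theorem EE_card : EE.ncard = 460 := by
  rw [← Set.InjOn.ncard_image code5_inj, code5_image, Set.ncard_coe_finset, cntN_eq]
  exact beq460 _ cnt_ok


theorem Sset_indep : LinearIndependent (ZMod 2) (fun x : Sset => (x : QP 5 67)) := by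
  rw [Sset_eq]
  exact vE_indep.linearIndepOn_id

theorem Sset_card : Sset.ncard = 460 := by
  rw [Sset_eq, ← Set.image_univ, Set.ncard_image_of_injective _ vE_indep.injective, Set.ncard_univ,
    Nat.card_coe_set_eq, EE_card]

/-- this set of classes is a basis of `(QP_5^0)_67` and has exactly
`460` elements. -/
theorem statement2 :
    Submodule.span (ZMod 2) Sset = Qzero 5 67 ∧
    LinearIndependent (ZMod 2) (fun x : Sset => (x : QP 5 67)) ∧
    Sset.ncard = 460 := by
  exact ⟨span_Sset, Sset_indep, Sset_card⟩

end
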